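/- There exists a constant C > 0 such that for every n ≥ 1 there exist unit vectors n₁,…,n_n in ℝ³ and weights α₁,…,α_n ≥ 0 with Σᵢ αᵢ = 1 such that for every unit vector c ∈ ℝ³, |Σᵢ αᵢ·|⟨nᵢ, c⟩| − 1/2| < C·n^{−5/4}. (Existence of zonotopes with n generator directions approximating the Euclidean ball in ℝ³ to accuracy n^{−1/2−3/4}.) -/

import Mathlib

open MeasureTheory
open scoped ContDiff

/-- Fresnel integral bound. -/
lemma zb_fresnel0 (α : ℝ) (hα : α ≠ 0) (X : ℝ) (hX : 0 ≤ X) :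
    ‖∫ s in (0:ℝ)..X, Complex.exp (Complex.I * (α * s ^ 2 : ℝ))‖ ≤ 2 / √|α| := by
  have hs : 0 < √|α| := Real.sqrt_pos.mpr (abs_pos.mpr hα)
  have hnorm : ∀ s : ℝ, ‖Complex.exp (Complex.I * (α * s ^ 2 : ℝ))‖ = 1 := fun s => by
    rw [mul_comm]; exact Complex.norm_exp_ofReal_mul_I _
  have hcont : Continuous fun s : ℝ => Complex.exp (Complex.I * (α * s ^ 2 : ℝ)) := by fun_prop
  set δ : ℝ := 1 / √|α| with hδ
  have hδ0 : 0 < δ := by positivity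
  have htriv : ∀ Y : ℝ, 0 ≤ Y → ‖∫ s in (0:ℝ)..Y, Complex.exp (Complex.I * (α * s ^ 2 : ℝ))‖ ≤ Y := by
    intro Y hY
    have := intervalIntegral.norm_integral_le_of_norm_le_const (a := 0) (b := Y) (C := 1)
      (f := fun s : ℝ => Complex.exp (Complex.I * (α * s ^ 2 : ℝ))) (fun x _ => (hnorm x).le)
    simpa [abs_of_nonneg hY] using this
  by_cases hXδ : X ≤ δ
  · refine (htriv X hX).trans (hXδ.trans ?_)
    rw [hδ]; gcongr; norm_num
  push Not at hXδ
  have hne : ∀ s ∈ Set.uIcc δ X, s ≠ 0 := by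
    intro s hs'
    rw [Set.uIcc_of_le hXδ.le] at hs'
    exact (hδ0.trans_le hs'.1).ne'
  have hcα : (α : ℂ) ≠ 0 := by exact_mod_cast hα
  have hder : ∀ s ∈ Set.uIcc δ X, HasDerivAt
      (fun s : ℝ => Complex.exp (Complex.I * (α * s ^ 2 : ℝ)) / (2 * Complex.I * α * s))
      (Complex.exp (Complex.I * (α * s ^ 2 : ℝ)) -
        Complex.exp (Complex.I * (α * s ^ 2 : ℝ)) / (2 * Complex.I * α * s ^ 2)) s := by
    intro s hs'
    have hs0 : (s : ℂ) ≠ 0 := by exact_mod_cast hne s hs'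
    have h1 : HasDerivAt (fun s : ℝ => (s : ℂ)) 1 s := Complex.ofRealCLM.hasDerivAt
    have h2 : HasDerivAt (fun s : ℝ => Complex.exp (Complex.I * (α * (s:ℂ) ^ 2)))
        (Complex.exp (Complex.I * (α * (s:ℂ) ^ 2)) * (Complex.I * (α * (2 * (s:ℂ) * 1)))) s := by
      have := ((((h1.pow 2).const_mul (α:ℂ)).const_mul Complex.I)).cexp
      convert! this using 1
      simp
    have h3 := h2.div (h1.const_mul (2 * Complex.I * α)) (by simp [hs0, hcα])
    convert! h3 using 1
    · funext t; push_cast; rfl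
    · push_cast
      field_simp
  have hci : ContinuousOn (fun s : ℝ => Complex.exp (Complex.I * (α * s ^ 2 : ℝ)) /
      (2 * Complex.I * α * s ^ 2)) (Set.uIcc δ X) := by
    refine hcont.continuousOn.div (by fun_prop) ?_
    intro s hs'
    have hs0 : (s : ℂ) ≠ 0 := by exact_mod_cast hne s hs'
    simp [hs0, hcα]
  have hintg := intervalIntegral.integral_eq_sub_of_hasDerivAt hder
    ((hcont.continuousOn.sub hci).intervalIntegrable)
  rw [intervalIntegral.integral_sub (hcont.intervalIntegrable _ _) hci.intervalIntegrable] at hintg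
  have hbd : ∀ s : ℝ, 0 < s → ‖Complex.exp (Complex.I * (α * s ^ 2 : ℝ)) / (2 * Complex.I * α * s)‖
      = 1 / (2 * |α| * s) := by
    intro s hs'
    rw [norm_div, hnorm]
    simp [abs_of_pos hs']
  have hrem : ‖∫ s in δ..X, Complex.exp (Complex.I * (α * s ^ 2 : ℝ)) /
      (2 * Complex.I * α * s ^ 2)‖ ≤ 1 / (2 * |α|) * (1 / δ - 1 / X) := by
    have hd2 : ∀ s ∈ Set.uIcc δ X, HasDerivAt (fun s : ℝ => -(1 / (2 * |α|)) * s⁻¹)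
        (1 / (2 * |α|) * (s ^ 2)⁻¹) s := by
      intro s hs'
      have := (hasDerivAt_inv (hne s hs')).const_mul (-(1 / (2 * |α|)))
      convert! this using 1
      ring
    have hci2 : ContinuousOn (fun s : ℝ => 1 / (2 * |α|) * (s ^ 2)⁻¹) (Set.uIcc δ X) :=
      continuousOn_const.mul ((continuousOn_id.pow 2).inv₀ fun s hs' => pow_ne_zero 2 (hne s hs'))
    have hI2 := intervalIntegral.integral_eq_sub_of_hasDerivAt hd2 hci2.intervalIntegrable
    have := intervalIntegral.norm_integral_le_of_norm_le (μ := volume) hXδ.le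
      (f := fun s : ℝ => Complex.exp (Complex.I * (α * s ^ 2 : ℝ)) / (2 * Complex.I * α * s ^ 2))
      (g := fun s : ℝ => 1 / (2 * |α|) * (s ^ 2)⁻¹) (by
        refine Filter.Eventually.of_forall fun s _ => ?_
        rw [norm_div, hnorm]
        simp [mul_comm]) hci2.intervalIntegrable
    rw [hI2] at this
    refine this.trans (le_of_eq ?_)
    ring
  have hXp : 0 < X := hδ0.trans hXδ
  have hsplit := intervalIntegral.integral_add_adjacent_intervals
    (hcont.intervalIntegrable (μ := volume) 0 δ) (hcont.intervalIntegrable δ X)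
  rw [← hsplit]
  have h2 : ‖∫ s in δ..X, Complex.exp (Complex.I * (α * s ^ 2 : ℝ))‖ ≤ 1 / √|α| := by
    rw [sub_eq_iff_eq_add] at hintg
    rw [hintg]
    refine (norm_add_le _ _).trans ?_
    refine (add_le_add (norm_sub_le _ _) hrem).trans ?_
    rw [hbd X hXp, hbd δ hδ0]
    have ha : 0 < |α| := abs_pos.mpr hα
    have hsq : √|α| * √|α| = |α| := Real.mul_self_sqrt ha.le
    have e1 : 1 / (2 * |α| * X) + 1 / (2 * |α| * δ) + 1 / (2 * |α|) * (1 / δ - 1 / X) =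
        1 / (|α| * δ) := by field_simp; ring
    rw [e1, hδ]
    apply le_of_eq
    rw [show 1 / (|α| * (1 / √|α|)) = 1 / √|α| from by
      rw [mul_one_div]; congr 1; rw [div_eq_iff hs.ne', hsq]]
  calc _ ≤ _ := norm_add_le _ _
    _ ≤ δ + 1 / √|α| := add_le_add (htriv δ hδ0.le) h2
    _ = _ := by rw [hδ]; ring

lemma zb_fresnel1 (α : ℝ) (hα : α ≠ 0) (X : ℝ) :
    ‖∫ s in (0:ℝ)..X, Complex.exp (Complex.I * (α * s ^ 2 : ℝ))‖ ≤ 2 / √|α| := by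
  rcases le_total 0 X with h | h
  · exact zb_fresnel0 α hα X h
  · have := zb_fresnel0 α hα (-X) (by linarith)
    have h2 := intervalIntegral.integral_comp_neg
      (fun s : ℝ => Complex.exp (Complex.I * (α * s ^ 2 : ℝ))) (a := 0) (b := -X)
    simp only [neg_neg, neg_zero, neg_sq] at h2
    rw [h2, intervalIntegral.integral_symm, norm_neg] at this
    exact this

lemma zb_fresnel2 (α β γ : ℝ) (hα : α ≠ 0) (x y : ℝ) :
    ‖∫ s in x..y, Complex.exp (Complex.I * (α * s ^ 2 + β * s + γ : ℝ))‖ ≤ 4 / √|α| := by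
  have hcont : Continuous fun s : ℝ => Complex.exp (Complex.I * (α * s ^ 2 : ℝ)) := by fun_prop
  have e : ∀ s : ℝ, Complex.exp (Complex.I * (α * s ^ 2 + β * s + γ : ℝ)) =
      Complex.exp (Complex.I * (γ - β ^ 2 / (4 * α) : ℝ)) *
      Complex.exp (Complex.I * (α * (s + β / (2 * α)) ^ 2 : ℝ)) := by
    intro s
    rw [← Complex.exp_add, ← mul_add, ← Complex.ofReal_add]
    congr 3
    field_simp
    ring
  simp_rw [e]
  rw [intervalIntegral.integral_const_mul, norm_mul, mul_comm Complex.I,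
    Complex.norm_exp_ofReal_mul_I, one_mul,
    intervalIntegral.integral_comp_add_right
      (fun s : ℝ => Complex.exp (Complex.I * (α * s ^ 2 : ℝ)))]
  rw [← intervalIntegral.integral_interval_sub_left (a := 0)
    (hcont.intervalIntegrable _ _) (hcont.intervalIntegrable _ _)]
  refine (norm_sub_le _ _).trans ?_
  refine (add_le_add (zb_fresnel1 α hα _) (zb_fresnel1 α hα _)).trans (le_of_eq ?_)
  ring

/-- Oscillatory integral with a quadratic phase and a C¹ amplitude. -/
lemma zb_osc1 (α β γ : ℝ) (hα : α ≠ 0) (A A' : ℝ → ℝ) (D : ℝ)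
    (hA : ∀ t, HasDerivAt A (A' t) t) (hA'c : Continuous A') (hD : ∀ t, |A' t| ≤ D)
    (hsupp : ∀ t, t ∉ Set.Ioo (0:ℝ) 1 → A t = 0) :
    ‖∫ t : ℝ, (A t : ℂ) * Complex.exp (Complex.I * (α * t ^ 2 + β * t + γ : ℝ))‖
      ≤ 4 * D / √|α| := by
  have hs : 0 < √|α| := Real.sqrt_pos.mpr (abs_pos.mpr hα)
  have hcont : Continuous fun s : ℝ => Complex.exp (Complex.I * (α * s ^ 2 + β * s + γ : ℝ)) := by
    fun_prop
  rw [← intervalIntegral.integral_eq_integral_of_support_subset (a := 0) (b := 1) (by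
    intro t ht
    by_contra hc
    apply ht
    simp only
    rw [hsupp t (fun h => hc ⟨h.1, h.2.le⟩)]; simp)]
  have hΦ : ∀ t : ℝ, HasDerivAt
      (fun t : ℝ => ∫ s in (0:ℝ)..t, Complex.exp (Complex.I * (α * s ^ 2 + β * s + γ : ℝ)))
      (Complex.exp (Complex.I * (α * t ^ 2 + β * t + γ : ℝ))) t := fun t =>
    intervalIntegral.integral_hasDerivAt_right (hcont.intervalIntegrable _ _)
      (hcont.stronglyMeasurableAtFilter _ _) hcont.continuousAt
  have hAc : ∀ t : ℝ, HasDerivAt (fun t : ℝ => (A t : ℂ)) (A' t : ℂ) t := fun t => (hA t).ofReal_comp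
  have hib := intervalIntegral.integral_mul_deriv_eq_deriv_mul (a := 0) (b := 1)
    (fun t _ => hAc t) (fun t _ => hΦ t)
    ((Complex.continuous_ofReal.comp hA'c).intervalIntegrable _ _) (hcont.intervalIntegrable _ _)
  rw [hib, hsupp 0 (by simp), hsupp 1 (by simp)]
  simp only [Complex.ofReal_zero, zero_mul, sub_zero, zero_sub, norm_neg]
  have := intervalIntegral.norm_integral_le_of_norm_le_const (a := 0) (b := 1) (C := 4 * D / √|α|)
    (f := fun t : ℝ => (A' t : ℂ) *
      ∫ s in (0:ℝ)..t, Complex.exp (Complex.I * (α * s ^ 2 + β * s + γ : ℝ))) (by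
      intro t _
      rw [norm_mul, Complex.norm_real, Real.norm_eq_abs]
      calc _ ≤ D * (4 / √|α|) := by
            gcongr
            · exact (abs_nonneg _).trans (hD t)
            · exact hD t
            · exact zb_fresnel2 α β γ hα 0 t
        _ = _ := by ring)
  simpa using this


/-- The box which carries all the amplitudes. -/
def zbBox : Set (ℝ × ℝ) := Set.Icc (1/20) (7/20) ×ˢ Set.Icc (1/20) (7/20)

/-- Smooth functions supported in the box. -/
structure ZbD (φ : ℝ × ℝ → ℝ) : Prop where
  smooth : ContDiff ℝ ∞ φ
  supp : ∀ p, p ∉ zbBox → φ p = 0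

/-- The oscillating factor. -/
noncomputable def zbE (κ₁ κ₂ κ : ℝ) (p : ℝ × ℝ) : ℂ :=
  Complex.exp (Complex.I * (κ₁ * p.1 + κ₂ * p.2 + κ * (p.1 ^ 2 + p.2 ^ 2) : ℝ))

lemma zbE_cont (κ₁ κ₂ κ : ℝ) : Continuous (zbE κ₁ κ₂ κ) := by unfold zbE; fun_prop

lemma zbE_norm (κ₁ κ₂ κ : ℝ) (p : ℝ × ℝ) : ‖zbE κ₁ κ₂ κ p‖ = 1 := by
  unfold zbE; rw [mul_comm]; exact Complex.norm_exp_ofReal_mul_I _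

lemma zbBox_compact : IsCompact zbBox := isCompact_Icc.prod isCompact_Icc

lemma ZbD.hcs {φ : ℝ × ℝ → ℝ} (h : ZbD φ) : HasCompactSupport φ :=
  HasCompactSupport.intro zbBox_compact h.supp

/-- any continuous function times a compactly supported one is integrable -/
lemma zb_integrable {φ : ℝ × ℝ → ℝ} (hc : Continuous φ) (hs : ∀ p, p ∉ zbBox → φ p = 0)
    {f : ℝ × ℝ → ℂ} (hf : Continuous f) :
    Integrable (fun p => (φ p : ℂ) * f p) := by
  apply Continuous.integrable_of_hasCompactSupport
  · fun_prop
  · exact HasCompactSupport.intro zbBox_compact fun p hp => by simp [hs p hp]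

lemma zb_planeA {φ : ℝ × ℝ → ℝ} (hφ : ZbD φ) : ∃ C : ℝ, 0 ≤ C ∧ ∀ κ₁ κ₂ κ : ℝ, κ ≠ 0 →
    ∀ a b c : ℝ, |a| ≤ |b| → ∀ H : ℝ → ℝ, Continuous H → ∀ N : ℝ,
    (∫ s in (-1:ℝ)..1, |H (b * s + c)|) ≤ N →
    ‖∫ p : ℝ × ℝ, ((H (a * p.1 + b * p.2 + c) * φ p : ℝ) : ℂ) * zbE κ₁ κ₂ κ p‖
      ≤ C * N / √|κ| := by
  have hdc : Continuous (fderiv ℝ φ) := hφ.smooth.continuous_fderiv (by simp)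
  obtain ⟨D, hD⟩ := (hφ.hcs.fderiv (𝕜 := ℝ)).exists_bound_of_continuous hdc
  have hD0 : 0 ≤ D := (norm_nonneg _).trans (hD 0)
  refine ⟨4 * D, by positivity, ?_⟩
  intro κ₁ κ₂ κ hκ a b c hab H hH N hN
  have hφc : Continuous φ := hφ.smooth.continuous
  set θ : ℝ := -a / b with hθ
  have hθ1 : |θ| ≤ 1 := by
    rw [hθ, abs_div, abs_neg]
    exact div_le_one_of_le₀ hab (abs_nonneg _)
  have hbθ : a + b * θ = 0 := by
    by_cases hb : b = 0
    · have : a = 0 := by simpa [hb] using hab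
      simp [this, hb]
    · rw [hθ]; field_simp; ring
  set f : ℝ × ℝ → ℂ := fun p => ((H (a * p.1 + b * p.2 + c) * φ p : ℝ) : ℂ) * zbE κ₁ κ₂ κ p with hf
  have hfc : Continuous f := by
    have := zbE_cont κ₁ κ₂ κ
    rw [hf]; fun_prop
  have hfs : ∀ p, p ∉ zbBox → f p = 0 := fun p hp => by simp [hf, hφ.supp p hp]
  have hfi : Integrable f :=
    hfc.integrable_of_hasCompactSupport (HasCompactSupport.intro zbBox_compact hfs)
  have hmem : ∀ u v : ℝ, (u, v + θ * u) ∈ zbBox → u ∈ Set.Ioo (0:ℝ) 1 ∧ v ∈ Set.Ioo (-1:ℝ) 1 := by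
    rintro u v ⟨⟨h1, h2⟩, h3, h4⟩
    simp only at h1 h2 h3 h4
    have : |θ * u| ≤ 7/20 := by
      rw [abs_mul]
      calc |θ| * |u| ≤ 1 * (7/20) := by
            gcongr
            rw [abs_le]; constructor <;> linarith
        _ = _ := by norm_num
    rw [abs_le] at this
    refine ⟨⟨by linarith, by linarith⟩, by linarith, by linarith⟩
  have hshear : Integrable (fun p : ℝ × ℝ => f (p.1, p.2 + θ * p.1)) := by
    apply Continuous.integrable_of_hasCompactSupport
    · fun_prop
    · refine HasCompactSupport.intro (K := Set.Icc (0:ℝ) 1 ×ˢ Set.Icc (-1:ℝ) 1)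
        (isCompact_Icc.prod isCompact_Icc) ?_
      rintro ⟨u, v⟩ hp
      apply hfs
      intro hin
      obtain ⟨h1, h2⟩ := hmem u v hin
      exact hp ⟨⟨h1.1.le, h1.2.le⟩, h2.1.le, h2.2.le⟩
  have e1 : ∫ p, f p = ∫ v : ℝ, ∫ u : ℝ, f (u, v + θ * u) := by
    rw [Measure.volume_eq_prod, integral_prod f hfi]
    have : ∀ u : ℝ, ∫ v : ℝ, f (u, v) = ∫ v : ℝ, f (u, v + θ * u) := fun u =>
      (integral_add_right_eq_self (fun v => f (u, v)) (θ * u)).symm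
    simp_rw [this]
    exact integral_integral_swap (f := fun u v => f (u, v + θ * u)) hshear
  have hinner : ∀ v : ℝ, ‖∫ u : ℝ, f (u, v + θ * u)‖ ≤ |H (b * v + c)| * (4 * D / √|κ|) := by
    intro v
    have e2 : ∀ u : ℝ, f (u, v + θ * u) = (H (b * v + c) : ℂ) * ((φ (u, v + θ * u) : ℂ) *
        Complex.exp (Complex.I * ((κ * (1 + θ ^ 2)) * u ^ 2 +
          (κ₁ + κ₂ * θ + 2 * κ * v * θ) * u + (κ₂ * v + κ * v ^ 2) : ℝ))) := by
      intro u
      have h1 : a * u + b * (v + θ * u) + c = b * v + c := by linear_combination u * hbθ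
      simp only [hf, zbE, h1]
      rw [Complex.ofReal_mul, mul_assoc]
      congr 4
      push_cast
      ring
    simp_rw [e2]
    rw [integral_const_mul, norm_mul, Complex.norm_real, Real.norm_eq_abs]
    gcongr
    have hlin : ∀ u : ℝ, HasDerivAt (fun u : ℝ => (u, v + θ * u)) ((1:ℝ), θ) u := by
      intro u
      have := (hasDerivAt_id u).prodMk (((hasDerivAt_id u).const_mul θ).const_add v)
      simpa using this
    have hder : ∀ u : ℝ, HasDerivAt (fun u : ℝ => φ (u, v + θ * u))
        (fderiv ℝ φ (u, v + θ * u) (1, θ)) u := by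
      intro u
      exact ((hφ.smooth.differentiable (by simp)) _).hasFDerivAt.comp_hasDerivAt u (hlin u)
    have hα : κ * (1 + θ ^ 2) ≠ 0 := mul_ne_zero hκ (by positivity)
    have := zb_osc1 (κ * (1 + θ ^ 2)) (κ₁ + κ₂ * θ + 2 * κ * v * θ) (κ₂ * v + κ * v ^ 2) hα
      _ _ D hder (by fun_prop) (by
        intro t
        rw [← Real.norm_eq_abs]
        refine (ContinuousLinearMap.le_opNorm _ _).trans ?_
        have : ‖((1:ℝ), θ)‖ ≤ 1 := by
          rw [Prod.norm_def]; simp [hθ1]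
        calc _ ≤ D * 1 := by gcongr; exact hD _
          _ = D := mul_one _) (by
        intro t ht
        apply hφ.supp
        intro hin
        exact ht (hmem t v hin).1)
    refine this.trans ?_
    have hk : 0 < √|κ| := Real.sqrt_pos.mpr (abs_pos.mpr hκ)
    have hle : |κ| ≤ |κ * (1 + θ ^ 2)| := by
      rw [abs_mul]
      nlinarith [abs_nonneg κ, le_abs_self (1 + θ ^ 2), sq_nonneg θ]
    exact div_le_div_of_nonneg_left (by positivity) hk (Real.sqrt_le_sqrt hle)
  change ‖∫ p, f p‖ ≤ _
  rw [e1, ← intervalIntegral.integral_eq_integral_of_support_subset (a := -1) (b := 1) (by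
    intro v hv
    by_contra hc
    apply hv
    simp only
    rw [integral_eq_zero_of_ae]
    refine Filter.Eventually.of_forall fun u => ?_
    apply hfs
    intro hin
    have := (hmem u v hin).2
    exact hc ⟨this.1, this.2.le⟩)]
  have h3 := intervalIntegral.norm_integral_le_of_norm_le (μ := volume) (a := -1) (b := 1)
    (by norm_num) (f := fun v : ℝ => ∫ u : ℝ, f (u, v + θ * u))
    (g := fun v => |H (b * v + c)| * (4 * D / √|κ|))
    (Filter.Eventually.of_forall fun v _ => hinner v)
    (Continuous.intervalIntegrable (by fun_prop) _ _)
  refine h3.trans ?_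
  rw [intervalIntegral.integral_mul_const]
  calc _ ≤ N * (4 * D / √|κ|) := by gcongr
    _ = _ := by ring

lemma ZbD.swap {φ : ℝ × ℝ → ℝ} (h : ZbD φ) : ZbD (fun p => φ p.swap) where
  smooth := h.smooth.comp (contDiff_snd.prodMk contDiff_fst)
  supp _ hp := h.supp _ fun hin => hp ⟨hin.2, hin.1⟩

lemma zb_plane {φ : ℝ × ℝ → ℝ} (hφ : ZbD φ) : ∃ C : ℝ, 0 ≤ C ∧ ∀ κ₁ κ₂ κ : ℝ, κ ≠ 0 →
    ∀ a b c : ℝ, ∀ H : ℝ → ℝ, Continuous H → ∀ N : ℝ,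
    (|a| ≤ |b| → (∫ s in (-1:ℝ)..1, |H (b * s + c)|) ≤ N) →
    (|b| ≤ |a| → (∫ s in (-1:ℝ)..1, |H (a * s + c)|) ≤ N) →
    ‖∫ p : ℝ × ℝ, ((H (a * p.1 + b * p.2 + c) * φ p : ℝ) : ℂ) * zbE κ₁ κ₂ κ p‖
      ≤ C * N / √|κ| := by
  obtain ⟨C₁, h1, hC1⟩ := zb_planeA hφ
  obtain ⟨C₂, h2, hC2⟩ := zb_planeA hφ.swap
  refine ⟨C₁ + C₂, by positivity, ?_⟩
  intro κ₁ κ₂ κ hκ a b c H hH N hA hB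
  have hpos : ∀ x : ℝ, 0 ≤ ∫ s in (-1:ℝ)..1, |H (x * s + c)| := fun x =>
    intervalIntegral.integral_nonneg (by norm_num) fun _ _ => abs_nonneg _
  rcases le_total |a| |b| with hab | hab
  · have hN := (hpos _).trans (hA hab)
    refine (hC1 κ₁ κ₂ κ hκ a b c hab H hH N (hA hab)).trans ?_
    gcongr; linarith
  · have hN := (hpos _).trans (hB hab)
    have h3 := hC2 κ₂ κ₁ κ hκ b a c hab H hH N (hB hab)
    have e : ∫ p : ℝ × ℝ, ((H (a * p.1 + b * p.2 + c) * φ p : ℝ) : ℂ) * zbE κ₁ κ₂ κ p =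
        ∫ p : ℝ × ℝ, ((H (b * p.1 + a * p.2 + c) * φ p.swap : ℝ) : ℂ) * zbE κ₂ κ₁ κ p := by
      rw [Measure.volume_eq_prod, ← integral_prod_swap]
      congr 1
      funext p
      simp only [Prod.fst_swap, Prod.snd_swap, zbE]
      congr 4
      · ring_nf
      · ring
    rw [e]
    refine h3.trans ?_
    gcongr; linarith


lemma ZbD.add {φ ψ : ℝ × ℝ → ℝ} (h : ZbD φ) (h' : ZbD ψ) : ZbD (fun p => φ p + ψ p) where
  smooth := h.smooth.add h'.smooth
  supp p hp := by rw [h.supp p hp, h'.supp p hp, add_zero]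

lemma ZbD.mul {φ g : ℝ × ℝ → ℝ} (h : ZbD φ) (hg : ContDiff ℝ ∞ g) : ZbD (fun p => g p * φ p) where
  smooth := hg.mul h.smooth
  supp p hp := by rw [h.supp p hp, mul_zero]

lemma zbBox_closed : IsClosed zbBox := zbBox_compact.isClosed

lemma ZbD.eventually_zero {φ : ℝ × ℝ → ℝ} (h : ZbD φ) {p : ℝ × ℝ} (hp : p ∉ zbBox) :
    φ =ᶠ[nhds p] fun _ => 0 := by
  filter_upwards [zbBox_closed.isOpen_compl.mem_nhds hp] with q hq using h.supp q hq

lemma ZbD.fderiv {φ : ℝ × ℝ → ℝ} (h : ZbD φ) (e : ℝ × ℝ) : ZbD (fun p => fderiv ℝ φ p e) where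
  smooth := (h.smooth.fderiv_right (m := ∞) (by simp)).clm_apply contDiff_const
  supp p hp := by
    rw [(h.eventually_zero hp).fderiv_eq]; simp

/-- multipliers preserving the class -/
def ZbMul (m : ℝ × ℝ → ℝ) : Prop := ∀ φ, ZbD φ → ZbD (fun p => m p * φ p)

lemma zbMul_inv : ZbMul (fun p => p.2⁻¹) := by
  intro φ hφ
  refine ⟨contDiff_iff_contDiffAt.2 fun p => ?_, fun p hp => by rw [hφ.supp p hp, mul_zero]⟩
  by_cases hp : p ∈ zbBox
  · have h2 : p.2 ≠ 0 := by
      have := hp.2.1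
      intro h0; rw [h0] at this; norm_num at this
    exact (contDiffAt_snd.inv h2).mul hφ.smooth.contDiffAt
  · apply (contDiffAt_const (c := (0:ℝ))).congr_of_eventuallyEq
    filter_upwards [hφ.eventually_zero hp] with q hq
    rw [hq, mul_zero]

lemma zbMul_smooth {g : ℝ × ℝ → ℝ} (hg : ContDiff ℝ ∞ g) : ZbMul g := fun _ h => h.mul hg

lemma ZbMul.mul {m n : ℝ × ℝ → ℝ} (hm : ZbMul m) (hn : ZbMul n) : ZbMul (fun p => m p * n p) := by
  intro φ hφ
  have := hm _ (hn φ hφ)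
  simpa only [mul_assoc] using this

/-- integration by parts operator -/
noncomputable def zbT (m n φ : ℝ × ℝ → ℝ) : ℝ × ℝ → ℝ := fun p =>
  fderiv ℝ (fun p => m p * φ p) p (1, 0) + fderiv ℝ (fun p => n p * φ p) p (0, 1)

lemma zbT_mem {m n φ : ℝ × ℝ → ℝ} (hm : ZbMul m) (hn : ZbMul n) (h : ZbD φ) : ZbD (zbT m n φ) :=
  ((hm φ h).fderiv _).add ((hn φ h).fderiv _)

lemma zbE_hasFDeriv (κ₁ κ₂ κ : ℝ) (p e : ℝ × ℝ) :
    DifferentiableAt ℝ (zbE κ₁ κ₂ κ) p ∧ fderiv ℝ (zbE κ₁ κ₂ κ) p e =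
    Complex.I * ((κ₁ + 2 * κ * p.1) * e.1 + (κ₂ + 2 * κ * p.2) * e.2 : ℝ) * zbE κ₁ κ₂ κ p := by
  have h1 : HasFDerivAt (fun p : ℝ × ℝ => p.1) (ContinuousLinearMap.fst ℝ ℝ ℝ) p := hasFDerivAt_fst
  have h2 : HasFDerivAt (fun p : ℝ × ℝ => p.2) (ContinuousLinearMap.snd ℝ ℝ ℝ) p := hasFDerivAt_snd
  have hq := ((h1.const_mul κ₁).add (h2.const_mul κ₂)).add (((h1.pow 2).add (h2.pow 2)).const_mul κ)
  have hE := ((Complex.ofRealCLM.hasFDerivAt.comp p hq).const_mul Complex.I).cexp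
  have hE' : HasFDerivAt (zbE κ₁ κ₂ κ) _ p := hE
  refine ⟨hE'.differentiableAt, ?_⟩
  rw [hE'.fderiv]
  simp [zbE]
  ring

lemma zb_ibp {ψ : ℝ × ℝ → ℝ} (h : ZbD ψ) (κ₁ κ₂ κ : ℝ) (e : ℝ × ℝ) :
    ∫ p, (ψ p : ℂ) * (Complex.I * ((κ₁ + 2 * κ * p.1) * e.1 + (κ₂ + 2 * κ * p.2) * e.2 : ℝ)
      * zbE κ₁ κ₂ κ p) = - ∫ p, ((fderiv ℝ ψ p e : ℝ) : ℂ) * zbE κ₁ κ₂ κ p := by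
  have hc := zbE_cont κ₁ κ₂ κ
  have h3 := h.fderiv e
  have := integral_smul_fderiv_eq_neg_fderiv_smul_of_integrable (μ := (volume : Measure (ℝ × ℝ)))
    (f := ψ) (g := zbE κ₁ κ₂ κ) (v := e)
    (by simpa using zb_integrable h3.smooth.continuous h3.supp hc)
    (by
      simp_rw [(zbE_hasFDeriv κ₁ κ₂ κ _ e).2]
      have := zb_integrable h.smooth.continuous h.supp (f := fun p : ℝ × ℝ => Complex.I *
        ((κ₁ + 2 * κ * p.1) * e.1 + (κ₂ + 2 * κ * p.2) * e.2 : ℝ) * zbE κ₁ κ₂ κ p) (by fun_prop)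
      simpa using this)
    (by simpa using zb_integrable h.smooth.continuous h.supp hc)
    (fun p _ => h.smooth.differentiable (by simp) p)
    (fun p _ => (zbE_hasFDeriv κ₁ κ₂ κ p e).1)
  simp_rw [(zbE_hasFDeriv κ₁ κ₂ κ _ e).2] at this
  simpa using this

lemma zbT_ibp {m n φ : ℝ × ℝ → ℝ} (hm : ZbMul m) (hn : ZbMul n) (h : ZbD φ) (κ₁ κ μ : ℝ)
    (hμ : ∀ p ∈ zbBox, m p * (κ₁ + 2 * κ * p.1) + n p * (2 * κ * p.2) = μ) :
    Complex.I * μ * ∫ p, (φ p : ℂ) * zbE κ₁ 0 κ p = - ∫ p, (zbT m n φ p : ℂ) * zbE κ₁ 0 κ p := by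
  have hc := zbE_cont κ₁ 0 κ
  have h1 := zb_ibp (hm φ h) κ₁ 0 κ (1, 0)
  have h2 := zb_ibp (hn φ h) κ₁ 0 κ (0, 1)
  have i1 := zb_integrable (hm φ h).smooth.continuous (hm φ h).supp (f := fun p : ℝ × ℝ =>
    (Complex.I * ((κ₁ + 2 * κ * p.1) * ((1:ℝ),(0:ℝ)).1 + (0 + 2 * κ * p.2) * ((1:ℝ),(0:ℝ)).2 : ℝ)
      * zbE κ₁ 0 κ p)) (by fun_prop)
  have i2 := zb_integrable (hn φ h).smooth.continuous (hn φ h).supp (f := fun p : ℝ × ℝ =>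
    (Complex.I * ((κ₁ + 2 * κ * p.1) * ((0:ℝ),(1:ℝ)).1 + (0 + 2 * κ * p.2) * ((0:ℝ),(1:ℝ)).2 : ℝ)
      * zbE κ₁ 0 κ p)) (by fun_prop)
  have j1 := zb_integrable ((hm φ h).fderiv (1,0)).smooth.continuous ((hm φ h).fderiv (1,0)).supp hc
  have j2 := zb_integrable ((hn φ h).fderiv (0,1)).smooth.continuous ((hn φ h).fderiv (0,1)).supp hc
  have h12 := congrArg₂ (· + ·) h1 h2
  simp only at h12
  rw [← integral_add i1 i2, ← neg_add, ← integral_add j1 j2] at h12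
  have e2 : (fun p : ℝ × ℝ => (zbT m n φ p : ℂ) * zbE κ₁ 0 κ p) = fun p =>
      ((_root_.fderiv ℝ (fun p => m p * φ p) p (1, 0) : ℝ) : ℂ) * zbE κ₁ 0 κ p +
      ((_root_.fderiv ℝ (fun p => n p * φ p) p (0, 1) : ℝ) : ℂ) * zbE κ₁ 0 κ p := by
    funext p; simp [zbT, add_mul]
  rw [e2, ← h12, ← integral_const_mul]
  congr 1
  funext p
  by_cases hp : p ∈ zbBox
  · rw [← hμ p hp]; push_cast; ring
  · rw [h.supp p hp]; simp

/-- smooth convex approximations of the absolute value -/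
structure ZbF (F F1 F2 : ℝ → ℝ) : Prop where
  s0 : ContDiff ℝ ∞ F
  s1 : ContDiff ℝ ∞ F1
  c2 : Continuous F2
  d0 : ∀ x, HasDerivAt F (F1 x) x
  d1 : ∀ x, HasDerivAt F1 (F2 x) x
  b0 : ∀ x, |F x| ≤ |x| + 1
  b1 : ∀ x, |F1 x| ≤ 1
  p2 : ∀ x, 0 ≤ F2 x

lemma zb_ell_smooth (a b c : ℝ) : ContDiff ℝ ∞ (fun p : ℝ × ℝ => a * p.1 + b * p.2 + c) := by
  fun_prop

lemma zb_comp_fderiv {G G1 : ℝ → ℝ} (hG : ∀ x, HasDerivAt G (G1 x) x) {φ : ℝ × ℝ → ℝ}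
    (h : ZbD φ) (a b c : ℝ) (p e : ℝ × ℝ) :
    fderiv ℝ (fun p => G (a * p.1 + b * p.2 + c) * φ p) p e =
      G1 (a * p.1 + b * p.2 + c) * (a * e.1 + b * e.2) * φ p +
      G (a * p.1 + b * p.2 + c) * fderiv ℝ φ p e := by
  have h1 : HasFDerivAt (fun p : ℝ × ℝ => p.1) (ContinuousLinearMap.fst ℝ ℝ ℝ) p := hasFDerivAt_fst
  have h2 : HasFDerivAt (fun p : ℝ × ℝ => p.2) (ContinuousLinearMap.snd ℝ ℝ ℝ) p := hasFDerivAt_snd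
  have hq := ((h1.const_mul a).add (h2.const_mul b)).add_const c
  have h3 : HasFDerivAt (fun p : ℝ × ℝ => G (a * p.1 + b * p.2 + c)) _ p :=
    (hG (a * p.1 + b * p.2 + c)).comp_hasFDerivAt p hq
  have h4 : HasFDerivAt (fun p : ℝ × ℝ => G (a * p.1 + b * p.2 + c) * φ p) _ p :=
    h3.mul (h.smooth.differentiable (by simp) p).hasFDerivAt
  rw [h4.fderiv]
  simp
  ring

lemma zbT_comp {m n : ℝ × ℝ → ℝ} (hm : ZbMul m) (hn : ZbMul n) {G G1 : ℝ → ℝ}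
    (hG : ∀ x, HasDerivAt G (G1 x) x) {φ : ℝ × ℝ → ℝ} (h : ZbD φ) (a b c : ℝ) (p : ℝ × ℝ) :
    zbT m n (fun p => G (a * p.1 + b * p.2 + c) * φ p) p =
      G1 (a * p.1 + b * p.2 + c) * (a * (m p * φ p) + b * (n p * φ p)) +
      G (a * p.1 + b * p.2 + c) * zbT m n φ p := by
  have e1 : (fun p => m p * (G (a * p.1 + b * p.2 + c) * φ p)) =
    fun p : ℝ × ℝ => G (a * p.1 + b * p.2 + c) * (m p * φ p) := by funext p; ring
  have e2 : (fun p => n p * (G (a * p.1 + b * p.2 + c) * φ p)) =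
    fun p : ℝ × ℝ => G (a * p.1 + b * p.2 + c) * (n p * φ p) := by funext p; ring
  simp only [zbT]
  rw [e1, e2, zb_comp_fderiv hG (hm φ h), zb_comp_fderiv hG (hn φ h)]
  simp
  ring

lemma zbT_add {m n : ℝ × ℝ → ℝ} (hm : ZbMul m) (hn : ZbMul n) {φ ψ : ℝ × ℝ → ℝ}
    (h : ZbD φ) (h' : ZbD ψ) (p : ℝ × ℝ) :
    zbT m n (fun p => φ p + ψ p) p = zbT m n φ p + zbT m n ψ p := by
  have d : ∀ {f : ℝ × ℝ → ℝ}, ZbD f → DifferentiableAt ℝ f p := fun h =>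
    h.smooth.differentiable (by simp) p
  simp only [zbT, mul_add]
  rw [fderiv_fun_add (d (hm φ h)) (d (hm ψ h')), fderiv_fun_add (d (hn φ h)) (d (hn ψ h'))]
  simp
  ring


/-- oscillatory coefficient -/
noncomputable def zbc (a b c κ₁ κ : ℝ) (G : ℝ → ℝ) (φ : ℝ × ℝ → ℝ) : ℂ :=
  ∫ p : ℝ × ℝ, ((G (a * p.1 + b * p.2 + c) * φ p : ℝ) : ℂ) * zbE κ₁ 0 κ p

lemma zbc_step {m n : ℝ × ℝ → ℝ} (hm : ZbMul m) (hn : ZbMul n) {G G1 : ℝ → ℝ}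
    (hG : ∀ x, HasDerivAt G (G1 x) x) (hs : ContDiff ℝ ∞ G) (hc : Continuous G1)
    {φ : ℝ × ℝ → ℝ} (h : ZbD φ) (a b c κ₁ κ μ : ℝ)
    (hμ : ∀ p ∈ zbBox, m p * (κ₁ + 2 * κ * p.1) + n p * (2 * κ * p.2) = μ) :
    |μ| * ‖zbc a b c κ₁ κ G φ‖ ≤ |a| * ‖zbc a b c κ₁ κ G1 (fun p => m p * φ p)‖ +
      |b| * ‖zbc a b c κ₁ κ G1 (fun p => n p * φ p)‖ + ‖zbc a b c κ₁ κ G (zbT m n φ)‖ := by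
  have hE := zbE_cont κ₁ 0 κ
  have key := zbT_ibp hm hn (h.mul (hs.comp (zb_ell_smooth a b c))) κ₁ κ μ hμ
  simp only [Function.comp_def] at key
  have int : ∀ {H : ℝ → ℝ} {ψ : ℝ × ℝ → ℝ}, Continuous H → ZbD ψ → Integrable (fun p : ℝ × ℝ =>
      ((H (a * p.1 + b * p.2 + c) * ψ p : ℝ) : ℂ) * zbE κ₁ 0 κ p) := by
    intro H ψ hH hψ
    refine zb_integrable (φ := fun p => H (a * p.1 + b * p.2 + c) * ψ p) ?_ ?_ hE
    · have := hψ.smooth.continuous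
      fun_prop
    · intro p hp; rw [hψ.supp p hp, mul_zero]
  have e : ∫ p, (zbT m n (fun p => G (a * p.1 + b * p.2 + c) * φ p) p : ℂ) * zbE κ₁ 0 κ p =
      a * zbc a b c κ₁ κ G1 (fun p => m p * φ p) +
      b * zbc a b c κ₁ κ G1 (fun p => n p * φ p) + zbc a b c κ₁ κ G (zbT m n φ) := by
    simp only [zbc]
    rw [← integral_const_mul, ← integral_const_mul,
      ← integral_add ((int hc (hm φ h)).const_mul _) ((int hc (hn φ h)).const_mul _),
      ← integral_add (by
          exact ((int hc (hm φ h)).const_mul _).add ((int hc (hn φ h)).const_mul _))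
        (int hs.continuous (zbT_mem hm hn h))]
    congr 1
    funext p
    rw [zbT_comp hm hn hG h]
    push_cast
    ring
  rw [e] at key
  have h1 := congrArg norm key
  rw [norm_neg, norm_mul, norm_mul, Complex.norm_I, one_mul, Complex.norm_real,
    Real.norm_eq_abs] at h1
  have h2 : ‖zbc a b c κ₁ κ G φ‖ = ‖∫ p : ℝ × ℝ, ((G (a * p.1 + b * p.2 + c) * φ p : ℝ) : ℂ)
    * zbE κ₁ 0 κ p‖ := rfl
  rw [h2, h1]
  refine (norm_add₃_le).trans ?_
  simp

/-- second derivative bound -/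
lemma zbc_F2 {ψ : ℝ × ℝ → ℝ} (h : ZbD ψ) : ∃ C, 0 ≤ C ∧ ∀ F F1 F2, ZbF F F1 F2 →
    ∀ a b c κ₁ κ, κ ≠ 0 → |a| ≤ 30 → |b| ≤ 30 → |c| ≤ 30 →
      max |a| |b| * ‖zbc a b c κ₁ κ F2 ψ‖ ≤ C / √|κ| ∧
      ‖zbc a b c κ₁ κ F1 ψ‖ ≤ C / √|κ| ∧ ‖zbc a b c κ₁ κ F ψ‖ ≤ C / √|κ| := by
  obtain ⟨C, hC, H⟩ := zb_plane h
  refine ⟨122 * C, by positivity, ?_⟩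
  intro F F1 F2 hF a b c κ₁ κ hκ ha hb hc
  have hκ' : 0 < √|κ| := Real.sqrt_pos.2 (abs_pos.2 hκ)
  have hL : ∀ {H : ℝ → ℝ} {B : ℝ} (β : ℝ), Continuous H → (∀ s, |s| ≤ 1 → |H (β * s + c)| ≤ B) →
      (∫ s in (-1:ℝ)..1, |H (β * s + c)|) ≤ 2 * B := by
    intro H B β hH hB
    have : (∫ s in (-1:ℝ)..1, |H (β * s + c)|) ≤ ∫ s in (-1:ℝ)..1, B := by
      apply intervalIntegral.integral_mono_on (by norm_num)
      · exact Continuous.intervalIntegrable (by fun_prop) _ _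
      · exact Continuous.intervalIntegrable (by fun_prop) _ _
      · intro s hs; exact hB s (abs_le.2 hs)
    refine this.trans (le_of_eq ?_)
    simp; norm_num
  refine ⟨?_, ?_, ?_⟩
  · rcases eq_or_ne (max |a| |b|) 0 with h0 | h0
    · rw [h0, zero_mul]; positivity
    have hM : 0 < max |a| |b| := lt_of_le_of_ne (le_max_of_le_left (abs_nonneg a)) (Ne.symm h0)
    have key : ∀ β, |β| = max |a| |b| → (∫ s in (-1:ℝ)..1, |F2 (β * s + c)|) ≤ 2 / max |a| |b| := by
      intro β hβ
      have hβ0 : β ≠ 0 := by intro h; rw [h] at hβ; simp at hβ; exact h0 hβ.symm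
      have e : (∫ s in (-1:ℝ)..1, |F2 (β * s + c)|) = ∫ s in (-1:ℝ)..1, F2 (β * s + c) := by
        congr 1; funext s; exact abs_of_nonneg (hF.p2 _)
      have hcF2 := hF.c2
      have e2 : (∫ s in (-1:ℝ)..1, F2 (β * s + c)) = F1 (β * 1 + c) / β - F1 (β * (-1) + c) / β := by
        apply intervalIntegral.integral_eq_sub_of_hasDerivAt (f := fun s => F1 (β * s + c) / β)
        · intro s _
          have h1 : HasDerivAt (fun s => β * s + c) β s := by
            simpa using ((hasDerivAt_id s).const_mul β).add_const c
          have := ((hF.d1 (β * s + c)).comp s h1).div_const β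
          convert! this using 1
          field_simp
        · exact Continuous.intervalIntegrable (by fun_prop) _ _
      rw [e, e2, ← sub_div]
      refine (le_abs_self _).trans ?_
      rw [abs_div, hβ]
      gcongr
      have := hF.b1 (β * 1 + c)
      have := hF.b1 (β * (-1) + c)
      exact (abs_sub _ _).trans (by linarith)
    have := H κ₁ 0 κ hκ a b c F2 hF.c2 (2 / max |a| |b|)
      (fun hab => key b (by rw [max_eq_right hab])) (fun hab => key a (by rw [max_eq_left hab]))
    calc max |a| |b| * ‖zbc a b c κ₁ κ F2 ψ‖ ≤ max |a| |b| * (C * (2 / max |a| |b|) / √|κ|) := by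
          gcongr; exact this
      _ = 2 * C / √|κ| := by field_simp
      _ ≤ _ := by gcongr; norm_num
  · have k : ∀ β, (∫ s in (-1:ℝ)..1, |F1 (β * s + c)|) ≤ 2 * 1 := fun β =>
      hL β hF.s1.continuous fun s _ => hF.b1 _
    refine (H κ₁ 0 κ hκ a b c F1 hF.s1.continuous (2 * 1) (fun _ => k b) (fun _ => k a)).trans ?_
    refine div_le_div_of_nonneg_right ?_ hκ'.le
    linarith
  · have k : ∀ β, |β| ≤ 30 → (∫ s in (-1:ℝ)..1, |F (β * s + c)|) ≤ 2 * 61 := fun β hβ =>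
      hL β hF.s0.continuous fun s hs => by
        refine (hF.b0 _).trans ?_
        have := abs_add_le (β * s) c
        have : |β * s| ≤ 30 * 1 := by rw [abs_mul]; gcongr
        linarith
    refine (H κ₁ 0 κ hκ a b c F hF.s0.continuous (2 * 61) (fun _ => k b hb) (fun _ => k a ha)).trans ?_
    refine div_le_div_of_nonneg_right ?_ hκ'.le
    linarith

lemma zbc_key {m n : ℝ × ℝ → ℝ} (hm : ZbMul m) (hn : ZbMul n) {φ : ℝ × ℝ → ℝ} (h : ZbD φ) :
    ∃ C, 0 ≤ C ∧ ∀ F F1 F2, ZbF F F1 F2 →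
    ∀ a b c κ₁ κ μ, κ ≠ 0 → |a| ≤ 30 → |b| ≤ 30 → |c| ≤ 30 →
    (∀ p ∈ zbBox, m p * (κ₁ + 2 * κ * p.1) + n p * (2 * κ * p.2) = μ) →
      μ ^ 2 * ‖zbc a b c κ₁ κ F φ‖ ≤ C / √|κ| := by
  have hmp := hm φ h
  have hnp := hn φ h
  have hTp := zbT_mem hm hn h
  obtain ⟨C1, h1, H1⟩ := zbc_F2 (hm _ hmp)
  obtain ⟨C2, h2, H2⟩ := zbc_F2 (hn _ hmp)
  obtain ⟨C3, h3, H3⟩ := zbc_F2 (zbT_mem hm hn hmp)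
  obtain ⟨C4, h4, H4⟩ := zbc_F2 (hm _ hnp)
  obtain ⟨C5, h5, H5⟩ := zbc_F2 (hn _ hnp)
  obtain ⟨C6, h6, H6⟩ := zbc_F2 (zbT_mem hm hn hnp)
  obtain ⟨C7, h7, H7⟩ := zbc_F2 (hm _ hTp)
  obtain ⟨C8, h8, H8⟩ := zbc_F2 (hn _ hTp)
  obtain ⟨C9, h9, H9⟩ := zbc_F2 (zbT_mem hm hn hTp)
  refine ⟨30 * (C1 + C2 + C3) + 30 * (C4 + C5 + C6) + (30 * C7 + 30 * C8 + C9), by positivity, ?_⟩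
  intro F F1 F2 hF a b c κ₁ κ μ hκ ha hb hc hμ
  have s0 := zbc_step hm hn hF.d0 hF.s0 hF.s1.continuous h a b c κ₁ κ μ hμ
  have s1 := zbc_step hm hn hF.d1 hF.s1 hF.c2 hmp a b c κ₁ κ μ hμ
  have s2 := zbc_step hm hn hF.d1 hF.s1 hF.c2 hnp a b c κ₁ κ μ hμ
  have s3 := zbc_step hm hn hF.d0 hF.s0 hF.s1.continuous hTp a b c κ₁ κ μ hμ
  replace H1 := (H1 F F1 F2 hF a b c κ₁ κ hκ ha hb hc).1
  replace H2 := (H2 F F1 F2 hF a b c κ₁ κ hκ ha hb hc).1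
  replace H3 := (H3 F F1 F2 hF a b c κ₁ κ hκ ha hb hc).2.1
  replace H4 := (H4 F F1 F2 hF a b c κ₁ κ hκ ha hb hc).1
  replace H5 := (H5 F F1 F2 hF a b c κ₁ κ hκ ha hb hc).1
  replace H6 := (H6 F F1 F2 hF a b c κ₁ κ hκ ha hb hc).2.1
  replace H7 := (H7 F F1 F2 hF a b c κ₁ κ hκ ha hb hc).2.1
  replace H8 := (H8 F F1 F2 hF a b c κ₁ κ hκ ha hb hc).2.1
  replace H9 := (H9 F F1 F2 hF a b c κ₁ κ hκ ha hb hc).2.2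
  have ma : |a| ≤ max |a| |b| := le_max_left _ _
  have mb : |b| ≤ max |a| |b| := le_max_right _ _
  have G1 := (mul_le_mul_of_nonneg_right ma (norm_nonneg _)).trans H1
  have G2 := (mul_le_mul_of_nonneg_right mb (norm_nonneg _)).trans H2
  have G4 := (mul_le_mul_of_nonneg_right ma (norm_nonneg _)).trans H4
  have G5 := (mul_le_mul_of_nonneg_right mb (norm_nonneg _)).trans H5
  have t1 := s1.trans (add_le_add (add_le_add G1 G2) H3)
  have t2 := s2.trans (add_le_add (add_le_add G4 G5) H6)
  have t3 := s3.trans (add_le_add (add_le_add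
    (mul_le_mul ha H7 (norm_nonneg _) (by norm_num))
    (mul_le_mul hb H8 (norm_nonneg _) (by norm_num))) H9)
  have u1 := mul_le_mul ha t1 (by positivity) (by norm_num)
  have u2 := mul_le_mul hb t2 (by positivity) (by norm_num)
  have u := mul_le_mul_of_nonneg_left s0 (abs_nonneg μ)
  rw [← sq_abs]
  calc |μ| ^ 2 * ‖zbc a b c κ₁ κ F φ‖ = |μ| * (|μ| * ‖zbc a b c κ₁ κ F φ‖) := by ring
    _ ≤ _ := u
    _ ≤ 30 * (C1 / √|κ| + C2 / √|κ| + C3 / √|κ|) + 30 * (C4 / √|κ| + C5 / √|κ| + C6 / √|κ|) +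
      (30 * (C7 / √|κ|) + 30 * (C8 / √|κ|) + C9 / √|κ|) := by linarith
    _ = _ := by ring


lemma zbF_sqrt (ε : ℝ) (h0 : 0 < ε) (h1 : ε ≤ 1) :
    ZbF (fun x => √(x ^ 2 + ε ^ 2)) (fun x => x / √(x ^ 2 + ε ^ 2))
      (fun x => ε ^ 2 / (√(x ^ 2 + ε ^ 2)) ^ 3) := by
  have hp : ∀ x : ℝ, 0 < x ^ 2 + ε ^ 2 := fun x => by positivity
  have hs : ∀ x : ℝ, 0 < √(x ^ 2 + ε ^ 2) := fun x => Real.sqrt_pos.2 (hp x)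
  have s0 : ContDiff ℝ ∞ (fun x : ℝ => √(x ^ 2 + ε ^ 2)) :=
    ContDiff.sqrt (by fun_prop) fun x => (hp x).ne'
  have d0 : ∀ x, HasDerivAt (fun x : ℝ => √(x ^ 2 + ε ^ 2)) (x / √(x ^ 2 + ε ^ 2)) x := by
    intro x
    have := (((hasDerivAt_id x).pow 2).add_const (ε ^ 2)).sqrt (hp x).ne'
    convert! this using 1
    have := (hs x).ne'
    simp
    field_simp
  refine ⟨s0, contDiff_id.div s0 fun x => (hs x).ne', ?_, d0, ?_, ?_, ?_, ?_⟩
  · exact continuous_const.div (s0.continuous.pow 3) fun x => (pow_pos (hs x) 3).ne'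
  · intro x
    have := (hasDerivAt_id x).div (d0 x) (hs x).ne'
    convert! this using 1
    have h := (hs x).ne'
    have h2 := Real.sq_sqrt (hp x).le
    simp only [id]
    field_simp
    linarith
  · intro x
    rw [abs_of_nonneg (Real.sqrt_nonneg _)]
    apply Real.sqrt_le_iff.2
    refine ⟨by positivity, ?_⟩
    have := abs_nonneg x
    nlinarith [sq_abs x]
  · intro x
    rw [abs_div, abs_of_pos (hs x), div_le_one (hs x)]
    apply Real.le_sqrt_of_sq_le
    rw [sq_abs]; nlinarith
  · intro x; have := hs x; positivity

lemma zbc_abs {m n : ℝ × ℝ → ℝ} (hm : ZbMul m) (hn : ZbMul n) {φ : ℝ × ℝ → ℝ} (h : ZbD φ) :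
    ∃ C, 0 ≤ C ∧ ∀ a b c κ₁ κ μ, κ ≠ 0 → |a| ≤ 30 → |b| ≤ 30 → |c| ≤ 30 →
    (∀ p ∈ zbBox, m p * (κ₁ + 2 * κ * p.1) + n p * (2 * κ * p.2) = μ) →
      μ ^ 2 * ‖zbc a b c κ₁ κ (fun x => |x|) φ‖ ≤ C / √|κ| := by
  obtain ⟨C, hC, H⟩ := zbc_key hm hn h
  refine ⟨C, hC, ?_⟩
  intro a b c κ₁ κ μ hκ ha hb hc hμ
  have hE := zbE_cont κ₁ 0 κ
  have int : ∀ {H : ℝ → ℝ} {ψ : ℝ × ℝ → ℝ}, Continuous H → ZbD ψ → Integrable (fun p : ℝ × ℝ =>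
      ((H (a * p.1 + b * p.2 + c) * ψ p : ℝ) : ℂ) * zbE κ₁ 0 κ p) := by
    intro H ψ hH hψ
    refine zb_integrable (φ := fun p => H (a * p.1 + b * p.2 + c) * ψ p) ?_ ?_ hE
    · have := hψ.smooth.continuous
      fun_prop
    · intro p hp; rw [hψ.supp p hp, mul_zero]
  have iφ : Integrable (fun p => |φ p|) := (h.smooth.continuous.integrable_of_hasCompactSupport h.hcs).abs
  set K := ∫ p, |φ p| with hK
  have hK0 : 0 ≤ K := integral_nonneg fun p => abs_nonneg _
  have main : ∀ ε : ℝ, 0 < ε → ε ≤ 1 →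
      μ ^ 2 * ‖zbc a b c κ₁ κ (fun x => |x|) φ‖ ≤ C / √|κ| + μ ^ 2 * K * ε := by
    intro ε h0 h1
    have hF := zbF_sqrt ε h0 h1
    have k := H _ _ _ hF a b c κ₁ κ μ hκ ha hb hc hμ
    have d : ‖zbc a b c κ₁ κ (fun x => |x|) φ - zbc a b c κ₁ κ (fun x => √(x ^ 2 + ε ^ 2)) φ‖
        ≤ ε * K := by
      simp only [zbc]
      rw [← integral_sub (int continuous_abs h) (int hF.s0.continuous h), hK, ← integral_const_mul]
      apply norm_integral_le_of_norm_le (iφ.const_mul ε)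
      refine Filter.Eventually.of_forall fun p => ?_
      rw [← sub_mul, ← Complex.ofReal_sub, ← sub_mul, norm_mul, zbE_norm, mul_one,
        Complex.norm_real, Real.norm_eq_abs, abs_mul]
      gcongr
      set x := a * p.1 + b * p.2 + c
      have l1 : |x| ≤ √(x ^ 2 + ε ^ 2) := by
        apply Real.le_sqrt_of_sq_le
        rw [sq_abs]; nlinarith
      have l2 : √(x ^ 2 + ε ^ 2) ≤ |x| + ε := by
        apply Real.sqrt_le_iff.2
        refine ⟨by positivity, ?_⟩
        have := abs_nonneg x
        nlinarith [sq_abs x]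
      rw [abs_le]; constructor <;> linarith
    have t : ‖zbc a b c κ₁ κ (fun x => |x|) φ‖ ≤
        ‖zbc a b c κ₁ κ (fun x => √(x ^ 2 + ε ^ 2)) φ‖ + ε * K := by
      have := norm_le_norm_add_norm_sub' (zbc a b c κ₁ κ (fun x => |x|) φ)
        (zbc a b c κ₁ κ (fun x => √(x ^ 2 + ε ^ 2)) φ)
      linarith
    have := mul_le_mul_of_nonneg_left t (sq_nonneg μ)
    linarith
  by_contra hcon
  push Not at hcon
  set L := μ ^ 2 * ‖zbc a b c κ₁ κ (fun x => |x|) φ‖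
  set δ := L - C / √|κ|
  have hδ : 0 < δ := by simp only [δ]; linarith
  have hB : 0 ≤ μ ^ 2 * K := by positivity
  have := main (min 1 (δ / (2 * (μ ^ 2 * K + 1)))) (by positivity) (min_le_left _ _)
  have h2 : μ ^ 2 * K * min 1 (δ / (2 * (μ ^ 2 * K + 1))) ≤ δ / 2 := by
    calc _ ≤ (μ ^ 2 * K + 1) * (δ / (2 * (μ ^ 2 * K + 1))) := by
          gcongr; · linarith
          · exact min_le_right _ _
      _ = δ / 2 := by field_simp
  simp only [δ] at *
  linarith

/-- main coefficient bound -/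
lemma zbc_bound {φ : ℝ × ℝ → ℝ} (h : ZbD φ) :
    ∃ C, 0 ≤ C ∧ ∀ a b c κ₁ κ, κ ≠ 0 → |a| ≤ 30 → |b| ≤ 30 → |c| ≤ 30 →
      (κ₁ ^ 2 + κ ^ 2) * ‖zbc a b c κ₁ κ (fun x => |x|) φ‖ ≤ C / √|κ| := by
  have hn1 : ZbMul (fun p => (-p.1) * p.2⁻¹) := (zbMul_smooth (by fun_prop)).mul zbMul_inv
  obtain ⟨C1, h1, H1⟩ := zbc_abs (zbMul_smooth (g := fun _ => 1) contDiff_const) hn1 h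
  obtain ⟨C2, h2, H2⟩ := zbc_abs (zbMul_smooth (g := fun _ => 0) contDiff_const) zbMul_inv h
  refine ⟨C1 + C2, by positivity, ?_⟩
  intro a b c κ₁ κ hκ ha hb hc
  have hp2 : ∀ p ∈ zbBox, p.2 ≠ 0 := by
    intro p hp h0
    have := hp.2.1
    rw [h0] at this; norm_num at this
  have k1 := H1 a b c κ₁ κ κ₁ hκ ha hb hc (fun p hp => by have := hp2 p hp; field_simp; ring)
  have k2 := H2 a b c κ₁ κ (2 * κ) hκ ha hb hc (fun p hp => by have := hp2 p hp; field_simp; ring)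
  have : 0 ≤ κ ^ 2 * ‖zbc a b c κ₁ κ (fun x => |x|) φ‖ := by positivity
  rw [add_div]
  nlinarith


/-- torus version of a compactly supported function on the open unit square -/
noncomputable def zbTor (G : ℝ × ℝ → ℂ) (x : UnitAddTorus (Fin 2)) : ℂ :=
  G ((AddCircle.equivIoc (1:ℝ) 0 (x 0) : ℝ), (AddCircle.equivIoc (1:ℝ) 0 (x 1) : ℝ))

lemma zbTor_coe (G : ℝ × ℝ → ℂ) (x : Fin 2 → ℝ) (hx : ∀ i, x i ∈ Set.Ioc (0:ℝ) (0 + 1)) :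
    zbTor G (fun i => (x i : UnitAddCircle)) = G (x 0, x 1) := by
  simp only [zbTor]
  rw [AddCircle.equivIoc_coe_eq (hx 0), AddCircle.equivIoc_coe_eq (hx 1)]

lemma zbTor_cont (G : ℝ × ℝ → ℂ) (hG : Continuous G) (δ : ℝ) (hδ : 0 < δ)
    (hs : ∀ p : ℝ × ℝ, p ∉ Set.Icc δ (1 - δ) ×ˢ Set.Icc δ (1 - δ) → G p = 0) :
    Continuous (zbTor G) := by
  set U : Set UnitAddCircle := ((fun x : ℝ => (x : UnitAddCircle)) '' Set.Icc δ (1 - δ))ᶜ with hU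
  have hcm : Continuous (fun x : ℝ => (x : UnitAddCircle)) := AddCircle.continuous_mk' (1:ℝ)
  have hUo : IsOpen U := by
    rw [hU, isOpen_compl_iff]
    exact (isCompact_Icc.image hcm).isClosed
  have hU0 : (((0:ℝ) : UnitAddCircle)) ∈ U := by
    rintro ⟨y, hy, h⟩
    simp only [QuotientAddGroup.mk_zero] at h
    have hy' : 0 < y := hδ.trans_le hy.1
    rw [AddCircle.coe_eq_zero_of_pos_iff (1:ℝ) one_pos hy'] at h
    obtain ⟨n, hn⟩ := h
    simp only [nsmul_eq_mul, mul_one] at hn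
    have h2 := hy.2
    have : (0:ℝ) < n ∧ (n:ℝ) < 1 := by rw [hn]; constructor <;> linarith
    have h3 : 0 < n ∧ n < 1 := by exact_mod_cast this
    omega
  have hUm : ∀ z ∈ U, (AddCircle.equivIoc (1:ℝ) 0 z : ℝ) ∉ Set.Icc δ (1 - δ) := by
    intro z hz h
    exact hz ⟨_, h, AddCircle.coe_equivIoc⟩
  rw [continuous_iff_continuousAt]
  intro x
  have hz : ∀ i, x i = ((0:ℝ) : UnitAddCircle) → ContinuousAt (zbTor G) x := by
    intro i hi
    have : zbTor G =ᶠ[nhds x] fun _ => 0 := by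
      have h1 : {y : UnitAddTorus (Fin 2) | y i ∈ U} ∈ nhds x :=
        (hUo.preimage (continuous_apply i)).mem_nhds (by simpa [hi] using hU0)
      filter_upwards [h1] with y hy
      have := hUm _ hy
      apply hs
      intro h
      fin_cases i
      · exact this h.1
      · exact this h.2
    exact this.continuousAt
  by_cases h0 : x 0 = ((0:ℝ) : UnitAddCircle)
  · exact hz 0 h0
  by_cases h1 : x 1 = ((0:ℝ) : UnitAddCircle)
  · exact hz 1 h1
  have c0 : ContinuousAt (fun y : UnitAddTorus (Fin 2) => (AddCircle.equivIoc (1:ℝ) 0 (y 0) : ℝ)) x :=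
    continuous_subtype_val.continuousAt.comp
      (ContinuousAt.comp (f := fun y : UnitAddTorus (Fin 2) => y 0)
        (AddCircle.continuousAt_equivIoc (1:ℝ) 0 h0) (continuous_apply 0).continuousAt)
  have c1 : ContinuousAt (fun y : UnitAddTorus (Fin 2) => (AddCircle.equivIoc (1:ℝ) 0 (y 1) : ℝ)) x :=
    continuous_subtype_val.continuousAt.comp
      (ContinuousAt.comp (f := fun y : UnitAddTorus (Fin 2) => y 1)
        (AddCircle.continuousAt_equivIoc (1:ℝ) 0 h1) (continuous_apply 1).continuousAt)
  exact hG.continuousAt.comp (c0.prodMk c1)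

/-- Fourier coefficient on the plane -/
noncomputable def zbHat (G : ℝ × ℝ → ℂ) (k : Fin 2 → ℤ) : ℂ :=
  ∫ p : ℝ × ℝ, Complex.exp (-2 * Real.pi * Complex.I * (k 0 * p.1 + k 1 * p.2)) * G p

lemma zbTor_coeff (G : ℝ × ℝ → ℂ) (δ : ℝ) (hδ : 0 < δ)
    (hs : ∀ p : ℝ × ℝ, p ∉ Set.Icc δ (1 - δ) ×ˢ Set.Icc δ (1 - δ) → G p = 0) (k : Fin 2 → ℤ) :
    UnitAddTorus.mFourierCoeff (zbTor G) k = zbHat G k := by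
  rw [UnitAddTorus.mFourierCoeff_eq_integral _ _ 0]
  have hS : MeasurableSet {x : Fin 2 → ℝ | ∀ i, x i ∈ Set.Ioc ((0 : Fin 2 → ℝ) i) ((0 : Fin 2 → ℝ) i + 1)} :=
    MeasurableSet.univ_pi' (fun i => measurableSet_Ioc)
  have e1 : ∫ (x : Fin 2 → ℝ) in {x : Fin 2 → ℝ | ∀ i, x i ∈ Set.Ioc ((0 : Fin 2 → ℝ) i) ((0 : Fin 2 → ℝ) i + 1)},
      UnitAddTorus.mFourier (-k) (fun i => (x i : UnitAddCircle)) • zbTor G (fun i => (x i : UnitAddCircle)) =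
      ∫ (x : Fin 2 → ℝ) in {x : Fin 2 → ℝ | ∀ i, x i ∈ Set.Ioc ((0 : Fin 2 → ℝ) i) ((0 : Fin 2 → ℝ) i + 1)},
        Complex.exp (-2 * Real.pi * Complex.I * (k 0 * x 0 + k 1 * x 1)) * G (x 0, x 1) := by
    apply setIntegral_congr_fun hS
    intro x hx
    simp only
    rw [zbTor_coe G x hx, smul_eq_mul]
    congr 1
    simp only [UnitAddTorus.mFourier, ContinuousMap.coe_mk, Fin.prod_univ_two, fourier_coe_apply,
      ← Complex.exp_add]
    congr 1
    simp
    ring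
  rw [e1, setIntegral_eq_integral_of_forall_compl_eq_zero]
  · rw [zbHat, ← (volume_preserving_finTwoArrow ℝ).integral_comp'
      (g := fun p : ℝ × ℝ => Complex.exp (-2 * Real.pi * Complex.I * (k 0 * p.1 + k 1 * p.2)) * G p)]
    rfl
  · intro x hx
    rw [hs, mul_zero]
    rintro ⟨h1, h2⟩
    apply hx
    intro i
    fin_cases i
    · have a1 := h1.1; have a2 := h1.2; simp at a1 a2 ⊢; constructor <;> linarith
    · have a1 := h2.1; have a2 := h2.2; simp at a1 a2 ⊢; constructor <;> linarith

lemma zb_geom (M : ℕ) (hM : 0 < M) (n : ℤ) :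
    ∑ a : Fin M, fourier n ((((a:ℕ) + 1 : ℝ) / M : ℝ) : UnitAddCircle) = if (M:ℤ) ∣ n then (M:ℂ) else 0 := by
  have hM' : (M:ℂ) ≠ 0 := by exact_mod_cast hM.ne'
  set z : ℂ := Complex.exp (2 * Real.pi * Complex.I * (n / M)) with hz
  have e : ∀ a : Fin M, fourier n ((((a:ℕ) + 1 : ℝ) / M : ℝ) : UnitAddCircle) = z * z ^ (a:ℕ) := by
    intro a
    rw [fourier_coe_apply, hz, ← Complex.exp_nat_mul, ← Complex.exp_add]
    congr 1
    push_cast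
    field_simp
    ring
  simp_rw [e]
  rw [← Finset.mul_sum, Fin.sum_univ_eq_sum_range (fun i => z ^ i) M]
  have hzM : z ^ M = 1 := by
    rw [hz, ← Complex.exp_nat_mul, Complex.exp_eq_one_iff]
    exact ⟨n, by field_simp⟩
  split_ifs with h
  · obtain ⟨q, rfl⟩ := h
    have : z = 1 := by
      rw [hz, Complex.exp_eq_one_iff]
      exact ⟨q, by push_cast; field_simp⟩
    rw [this]; simp
  · have : z ≠ 1 := by
      intro h1
      rw [hz, Complex.exp_eq_one_iff] at h1
      obtain ⟨q, hq⟩ := h1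
      apply h
      refine ⟨q, ?_⟩
      have hpi : (2 * Real.pi * Complex.I : ℂ) ≠ 0 := Complex.two_pi_I_ne_zero
      have : (n : ℂ) / M = q := by
        apply mul_left_cancel₀ hpi
        rw [hq]; ring
      field_simp at this
      exact_mod_cast this
    rw [geom_sum_eq this, hzM]; simp


lemma zb_quad (B : (Fin 2 → ℤ) → ℝ) (hB : Summable B) (hB0 : ∀ k, 0 ≤ B k)
    (hBM : ∀ (M : ℕ) (k : Fin 2 → ℤ), 0 < M → B (fun i => M * k i) ≤ (M:ℝ) ^ (-(5/2:ℝ)) * B k)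
    (G : ℝ × ℝ → ℂ) (hG : Continuous G) (δ : ℝ) (hδ : 0 < δ)
    (hs : ∀ p : ℝ × ℝ, p ∉ Set.Icc δ (1 - δ) ×ˢ Set.Icc δ (1 - δ) → G p = 0)
    (hk : ∀ k, k ≠ 0 → ‖zbHat G k‖ ≤ B k) (M : ℕ) (hM : 0 < M) :
    ‖((M:ℂ) ^ 2)⁻¹ * ∑ a : Fin M, ∑ b : Fin M, G (((a:ℕ) + 1 : ℝ) / M, ((b:ℕ) + 1 : ℝ) / M)
      - zbHat G 0‖ ≤ (M:ℝ) ^ (-(5/2:ℝ)) * ∑' k, B k := by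
  classical
  have hM' : (M:ℂ) ≠ 0 := by exact_mod_cast hM.ne'
  have hMr : (0:ℝ) < M := by exact_mod_cast hM
  set f : C(UnitAddTorus (Fin 2), ℂ) := ⟨zbTor G, zbTor_cont G hG δ hδ hs⟩ with hf
  have hc : ∀ k, UnitAddTorus.mFourierCoeff f k = zbHat G k := fun k => zbTor_coeff G δ hδ hs k
  have hsum : Summable (zbHat G) := by
    refine Summable.of_norm_bounded_eventually hB ?_
    refine Filter.eventually_cofinite.2 ((Set.finite_singleton (0 : Fin 2 → ℤ)).subset ?_)
    intro k hk'
    by_contra h0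
    exact hk' (hk k h0)
  have hsum' : Summable (UnitAddTorus.mFourierCoeff f) := by
    have e : UnitAddTorus.mFourierCoeff f = zbHat G := funext hc
    rw [e]; exact hsum
  have hx : ∀ a b : Fin M, HasSum (fun k : Fin 2 → ℤ => zbHat G k *
      (fourier (k 0) ((((a:ℕ) + 1 : ℝ) / M : ℝ) : UnitAddCircle) *
      fourier (k 1) ((((b:ℕ) + 1 : ℝ) / M : ℝ) : UnitAddCircle)))
      (G (((a:ℕ) + 1 : ℝ) / M, ((b:ℕ) + 1 : ℝ) / M)) := by
    intro a b
    have := UnitAddTorus.hasSum_mFourier_series_apply_of_summable hsum'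
      (fun i => ((![((a:ℕ) + 1 : ℝ) / M, ((b:ℕ) + 1 : ℝ) / M] i : ℝ) : UnitAddCircle))
    have e := zbTor_coe G ![((a:ℕ) + 1 : ℝ) / M, ((b:ℕ) + 1 : ℝ) / M] (by
      have : ∀ a : Fin M, ((a:ℕ) + 1 : ℝ) / M ∈ Set.Ioc (0:ℝ) (0 + 1) := by
        intro a
        refine ⟨by positivity, ?_⟩
        rw [zero_add, div_le_one hMr]
        exact_mod_cast a.2
      intro i
      fin_cases i
      · exact this a
      · exact this b)
    simp only [hf, ContinuousMap.coe_mk, e] at this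
    convert! this using 1
    funext k
    rw [← hc k]
    simp [UnitAddTorus.mFourier, Fin.prod_univ_two, hf]
  have h1 := hasSum_sum (s := (Finset.univ : Finset (Fin M))) fun a _ =>
    hasSum_sum (s := (Finset.univ : Finset (Fin M))) fun b _ => hx a b
  have e1 : ∀ k : Fin 2 → ℤ, (∑ a : Fin M, ∑ b : Fin M, zbHat G k *
      (fourier (k 0) ((((a:ℕ) + 1 : ℝ) / M : ℝ) : UnitAddCircle) *
      fourier (k 1) ((((b:ℕ) + 1 : ℝ) / M : ℝ) : UnitAddCircle))) =
      zbHat G k * ((if (M:ℤ) ∣ k 0 then (M:ℂ) else 0) * (if (M:ℤ) ∣ k 1 then (M:ℂ) else 0)) := by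
    intro k
    rw [← zb_geom M hM, ← zb_geom M hM, Finset.sum_mul_sum, Finset.mul_sum]
    congr 1; funext a; rw [Finset.mul_sum]
  simp only [e1] at h1
  have h2 := h1.mul_left (((M:ℂ) ^ 2)⁻¹)
  set S := ((M:ℂ) ^ 2)⁻¹ * ∑ a : Fin M, ∑ b : Fin M, G (((a:ℕ) + 1 : ℝ) / M, ((b:ℕ) + 1 : ℝ) / M)
  have hMz : (M:ℤ) ≠ 0 := by exact_mod_cast hM.ne'
  have inj : Function.Injective (fun (k : Fin 2 → ℤ) => (fun i => (M:ℤ) * k i)) := by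
    intro k l h
    funext i
    exact mul_left_cancel₀ hMz (congrFun h i)
  rw [← inj.hasSum_iff] at h2
  · have h3 : HasSum (fun k : Fin 2 → ℤ => zbHat G (fun i => M * k i)) S := by
      convert! h2 using 1
      funext k
      simp
      field_simp
    have h4 := h3.sub (hasSum_ite_eq (0 : Fin 2 → ℤ) (zbHat G 0))
    have hz : (fun i : Fin 2 => (M:ℤ) * (0 : Fin 2 → ℤ) i) = 0 := by funext i; simp
    rw [← h4.tsum_eq, ← tsum_mul_left]
    refine tsum_of_norm_bounded (hB.mul_left _).hasSum ?_
    intro k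
    by_cases hk0 : k = 0
    · rw [hk0, hz]; simp
      exact mul_nonneg (by positivity) (hB0 _)
    · rw [if_neg hk0, sub_zero]
      refine (hk _ ?_).trans (hBM M k hM)
      rw [← hz]; exact fun h => hk0 (inj h)
  · intro k hk
    by_cases h0 : (M:ℤ) ∣ k 0
    · by_cases h1 : (M:ℤ) ∣ k 1
      · exfalso
        apply hk
        obtain ⟨q, hq⟩ := h0
        obtain ⟨r, hr⟩ := h1
        refine ⟨![q, r], ?_⟩
        funext i
        fin_cases i
        · simpa using hq.symm
        · simpa using hr.symm
      · simp [h1]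
    · simp [h0]


noncomputable def zbBeta (k : Fin 2 → ℤ) : ℝ :=
  1 / (((k 1 : ℝ) ^ 2 + (k 0 + √2 * k 1) ^ 2) * √|k 0 + √2 * k 1|)

lemma zbTau_ne (m n : ℤ) (h : m ≠ 0 ∨ n ≠ 0) : (m + √2 * n : ℝ) ≠ 0 := by
  intro h0
  by_cases hn : n = 0
  · subst hn
    simp at h0
    simp [h0] at h
  · have hn' : (n:ℝ) ≠ 0 := by exact_mod_cast hn
    apply irrational_sqrt_two
    refine ⟨-m / n, ?_⟩
    push_cast
    field_simp
    linarith

lemma zbTau_lower (m n : ℤ) (hn : n ≠ 0) (h1 : |(m + √2 * n : ℝ)| ≤ 1) :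
    1 / (4 * |(n:ℝ)|) ≤ |(m + √2 * n : ℝ)| := by
  have hn1 : (1:ℝ) ≤ |(n:ℝ)| := by exact_mod_cast Int.one_le_abs hn
  have s2 : √2 ^ 2 = (2:ℝ) := Real.sq_sqrt (by norm_num)
  have s3 : √2 ≤ (3/2:ℝ) := by
    rw [Real.sqrt_le_iff]; norm_num
  have e : (m + √2 * n : ℝ) * (m - √2 * n) = ((m ^ 2 - 2 * n ^ 2 : ℤ) : ℝ) := by
    push_cast
    linear_combination (-(n:ℝ)^2) * s2
  have ne : (m + √2 * n : ℝ) * (m - √2 * n) ≠ 0 := by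
    apply mul_ne_zero (zbTau_ne m n (Or.inr hn))
    have := zbTau_ne m (-n) (Or.inr (neg_ne_zero.2 hn))
    push_cast at this
    intro h; apply this; linarith
  have i1 : (1:ℝ) ≤ |(m + √2 * n : ℝ) * (m - √2 * n)| := by
    rw [e] at ne ⊢
    have : (m ^ 2 - 2 * n ^ 2 : ℤ) ≠ 0 := by exact_mod_cast ne
    exact_mod_cast Int.one_le_abs this
  have i2 : |(m - √2 * n : ℝ)| ≤ 4 * |(n:ℝ)| := by
    have : (m - √2 * n : ℝ) = (m + √2 * n) - 2 * √2 * n := by ring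
    rw [this]
    refine (abs_sub _ _).trans ?_
    have : |2 * √2 * (n:ℝ)| = 2 * √2 * |(n:ℝ)| := by
      rw [abs_mul, abs_of_nonneg (by positivity)]
    rw [this]
    nlinarith
  rw [abs_mul] at i1
  rw [div_le_iff₀ (by positivity)]
  have := abs_nonneg (m + √2 * n : ℝ)
  nlinarith

lemma zb_sum1 : Summable (fun n : ℤ => (1 + |(n:ℝ)|) ^ (-(5/4:ℝ))) := by
  have h := (Real.summable_one_div_int_add_rpow (1/2) (5/4)).2 (by norm_num)
  refine Summable.of_nonneg_of_le (fun n => by positivity) (fun n => ?_) h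
  have hp : 0 < |(n:ℝ) + 1/2| := by
    rw [abs_pos]
    intro h0
    have : (2 * n + 1 : ℝ) = 0 := by linarith
    have : (2 * n + 1 : ℤ) = 0 := by exact_mod_cast this
    omega
  rw [Real.rpow_neg (by positivity), ← one_div]
  apply one_div_le_one_div_of_le (by positivity)
  apply Real.rpow_le_rpow hp.le _ (by norm_num)
  refine (abs_add_le _ _).trans ?_
  norm_num [abs_of_pos]
  linarith

lemma zbBeta_le (k : Fin 2 → ℤ) : zbBeta k ≤ 100 * ((1 + |((k 1 : ℤ):ℝ)|) ^ (-(5/4:ℝ)) *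
    (1 + |((k 0 + ⌊√2 * k 1⌋ : ℤ):ℝ)|) ^ (-(5/4:ℝ))) := by
  obtain ⟨m, hm⟩ : ∃ m, m = k 0 := ⟨_, rfl⟩
  obtain ⟨n, hn⟩ : ∃ n, n = k 1 := ⟨_, rfl⟩
  rw [zbBeta, ← hm, ← hn]
  set r : ℤ := m + ⌊√2 * n⌋ with hr
  set τ : ℝ := m + √2 * n with hτ
  have hf0 := Int.floor_le (√2 * n)
  have hf1 := Int.lt_floor_add_one (√2 * n)
  have hrr : (r:ℝ) = m + ⌊√2 * n⌋ := by rw [hr]; push_cast; ring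
  have hτ0 : (r:ℝ) ≤ τ := by rw [hrr, hτ]; linarith
  have hτ1 : τ < r + 1 := by rw [hrr, hτ]; linarith
  set s : ℝ := 1 + |(n:ℝ)| with hs
  set t : ℝ := 1 + |(r:ℝ)| with ht
  have hs1 : 1 ≤ s := by rw [hs]; linarith [abs_nonneg (n:ℝ)]
  have ht1 : 1 ≤ t := by rw [ht]; linarith [abs_nonneg (r:ℝ)]
  rw [Real.rpow_neg (by positivity), Real.rpow_neg (by positivity)]
  by_cases h00 : m = 0 ∧ n = 0
  · have : τ = 0 := by rw [hτ, h00.1, h00.2]; simp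
    rw [this]; simp; positivity
  have hτne : τ ≠ 0 := zbTau_ne m n (by tauto)
  have hτp : 0 < |τ| := abs_pos.2 hτne
  have hsq : 0 < √|τ| := Real.sqrt_pos.2 hτp
  have hpos : 0 < (n:ℝ) ^ 2 + τ ^ 2 := by positivity
  -- it suffices to bound from below
  suffices h : s ^ (5/4:ℝ) * t ^ (5/4:ℝ) ≤ 100 * (((n:ℝ) ^ 2 + τ ^ 2) * √|τ|) by
    rw [← mul_inv, div_le_iff₀ (by positivity), mul_assoc, mul_comm ((_)⁻¹), ← mul_assoc, 
      ← div_eq_mul_inv, le_div_iff₀ (by positivity), one_mul]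
    exact h
  by_cases hcase : r = 0 ∨ r = -1
  · have ht2 : t ≤ 2 := by
      rcases hcase with h | h <;> rw [ht, h] <;> norm_num
    have hτ' : |τ| ≤ 1 := by
      rcases hcase with h | h <;> rw [h] at hτ0 hτ1 <;> rw [abs_le] <;> push_cast at hτ0 hτ1 <;>
        constructor <;> linarith
    have htt : t ^ (5/4:ℝ) ≤ 4 := by
      calc t ^ (5/4:ℝ) ≤ t ^ (2:ℝ) := Real.rpow_le_rpow_of_exponent_le ht1 (by norm_num)
        _ = t ^ 2 := by norm_cast
        _ ≤ 4 := by nlinarith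
    by_cases hn0 : n = 0
    · have hs' : s = 1 := by rw [hs, hn0]; simp
      have hmr : τ = m := by rw [hτ, hn0]; simp
      have hm0 : m ≠ 0 := by tauto
      have : (1:ℝ) ≤ |τ| := by rw [hmr]; exact_mod_cast Int.one_le_abs hm0
      have h1 : |τ| = 1 := le_antisymm hτ' this
      rw [hs', h1, hn0, ← sq_abs τ, h1]
      simp; linarith
    · have hl := zbTau_lower m n hn0 hτ'
      set x := |(n:ℝ)| with hx
      have hx1 : (1:ℝ) ≤ x := by rw [hx]; exact_mod_cast Int.one_le_abs hn0
      have h1 : 1 / (2 * √x) ≤ √|τ| := by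
        apply Real.le_sqrt_of_sq_le
        rw [div_pow, mul_pow, Real.sq_sqrt (by positivity)]
        convert! hl using 2 <;> norm_num
      have h2 : s ^ (5/4:ℝ) ≤ 4 * x ^ (3/2:ℝ) := by
        calc s ^ (5/4:ℝ) ≤ s ^ (3/2:ℝ) := Real.rpow_le_rpow_of_exponent_le hs1 (by norm_num)
          _ ≤ (2 * x) ^ (3/2:ℝ) := Real.rpow_le_rpow (by positivity) (by linarith) (by norm_num)
          _ = 2 ^ (3/2:ℝ) * x ^ (3/2:ℝ) := Real.mul_rpow (by norm_num) (by positivity)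
          _ ≤ 2 ^ (2:ℝ) * x ^ (3/2:ℝ) := by
            gcongr
            · norm_num
            · norm_num
          _ = _ := by norm_num
      have h3 : x ^ (3/2:ℝ) = x ^ 2 * (1 / √x) := by
        rw [Real.sqrt_eq_rpow, one_div, ← Real.rpow_neg (by positivity), ← Real.rpow_natCast,
          ← Real.rpow_add (by positivity)]
        norm_num
      calc s ^ (5/4:ℝ) * t ^ (5/4:ℝ) ≤ (4 * x ^ (3/2:ℝ)) * 4 := by gcongr
        _ = 32 * (x ^ 2 * (1 / (2 * √x))) := by rw [h3]; field_simp; norm_num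
        _ ≤ 100 * (((n:ℝ) ^ 2 + τ ^ 2) * √|τ|) := by
          gcongr
          · norm_num
          · rw [hx, sq_abs]; nlinarith [sq_nonneg τ]
  · have hτt : t / 3 ≤ |τ| := by
      rcases lt_or_ge 0 r with h | h
      · have h' : (1:ℝ) ≤ r := by exact_mod_cast h
        rw [ht, abs_of_pos (by linarith : (0:ℝ) < r), abs_of_pos (by linarith)]
        linarith
      · have h1 : r ≤ -2 := by omega
        have h' : (r:ℝ) ≤ -2 := by exact_mod_cast h1
        rw [ht, abs_of_neg (by linarith : (r:ℝ) < 0), abs_of_neg (by linarith)]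
        linarith
    have ht2 : 2 ≤ t := by
      have : r ≠ 0 := by tauto
      have : (1:ℝ) ≤ |(r:ℝ)| := by exact_mod_cast Int.one_le_abs this
      rw [ht]; linarith
    have hA : s ^ 2 + t ^ 2 ≤ 20 * ((n:ℝ) ^ 2 + τ ^ 2) := by
      rw [← sq_abs (n:ℝ), ← sq_abs τ]
      have : (t / 3) ^ 2 ≤ |τ| ^ 2 := by gcongr
      nlinarith [sq_nonneg (|(n:ℝ)| - 1), abs_nonneg (n:ℝ)]
    have hB : s ^ (5/4:ℝ) * t ^ (3/4:ℝ) ≤ s ^ 2 + t ^ 2 := by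
      have hx : 1 ≤ max s t := hs1.trans (le_max_left _ _)
      calc s ^ (5/4:ℝ) * t ^ (3/4:ℝ) ≤ (max s t) ^ (5/4:ℝ) * (max s t) ^ (3/4:ℝ) := by
            gcongr
            · exact le_max_left _ _
            · exact le_max_right _ _
        _ = (max s t) ^ 2 := by
            rw [← Real.rpow_add (by positivity), ← Real.rpow_natCast]; norm_num
        _ ≤ _ := by
            rcases max_choice s t with h | h <;> rw [h] <;> nlinarith
    have hC : √t ≤ 2 * √|τ| := by
      rw [Real.sqrt_le_left (by positivity), mul_pow, Real.sq_sqrt (abs_nonneg _)]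
      linarith
    calc s ^ (5/4:ℝ) * t ^ (5/4:ℝ) = (s ^ (5/4:ℝ) * t ^ (3/4:ℝ)) * √t := by
          rw [Real.sqrt_eq_rpow, mul_assoc, ← Real.rpow_add (by positivity)]; norm_num
      _ ≤ (20 * ((n:ℝ) ^ 2 + τ ^ 2)) * (2 * √|τ|) := by
          exact mul_le_mul (hB.trans hA) hC (by positivity) (by positivity)
      _ ≤ _ := by nlinarith [mul_pos hpos hsq]

lemma zbBeta_nonneg (k) : 0 ≤ zbBeta k := by unfold zbBeta; positivity

lemma zbBeta_summable : Summable zbBeta := by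
  have h : Summable (fun q : ℤ × ℤ => (1 + |(q.1:ℝ)|) ^ (-(5/4:ℝ)) *
      (1 + |(q.2:ℝ)|) ^ (-(5/4:ℝ))) :=
    zb_sum1.mul_of_nonneg zb_sum1 (fun n => by positivity) (fun n => by positivity)
  have inj : Function.Injective (fun k : Fin 2 → ℤ => (k 1, k 0 + ⌊√2 * k 1⌋)) := by
    intro k l h
    simp only [Prod.mk.injEq] at h
    obtain ⟨h1, h2⟩ := h
    rw [h1] at h2
    funext i
    fin_cases i
    · simpa using h2
    · exact h1
  have h2 := h.comp_injective inj
  simp only [Function.comp_def] at h2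
  refine Summable.of_nonneg_of_le zbBeta_nonneg (fun k => zbBeta_le k) (h2.mul_left 100)

lemma zbBeta_scale (M : ℕ) (k : Fin 2 → ℤ) (hM : 0 < M) :
    zbBeta (fun i => M * k i) ≤ (M:ℝ) ^ (-(5/2:ℝ)) * zbBeta k := by
  have hMr : (0:ℝ) < M := by exact_mod_cast hM
  have e : (M:ℝ) ^ (-(5/2:ℝ)) = 1 / ((M:ℝ) ^ 2 * √M) := by
    rw [Real.rpow_neg hMr.le, one_div, Real.sqrt_eq_rpow, ← Real.rpow_natCast,
      ← Real.rpow_add hMr]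
    norm_num
  simp only [zbBeta, e]
  apply le_of_eq
  push_cast
  have e2 : (M * k 0 + √2 * (M * k 1) : ℝ) = M * (k 0 + √2 * k 1) := by ring
  rw [e2, abs_mul, abs_of_pos hMr, Real.sqrt_mul hMr.le, one_div_mul_one_div]
  congr 1
  ring


/-- change of variables -/
noncomputable def zbPhi (p : ℝ × ℝ) : ℝ × ℝ :=
  (p.1 ^ 2 + p.2 ^ 2, p.1 + √2 * (p.1 ^ 2 + p.2 ^ 2))

noncomputable def zbPsi (y : ℝ × ℝ) : ℝ × ℝ :=
  (y.2 - √2 * y.1, √(y.1 - (y.2 - √2 * y.1) ^ 2))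

lemma zbPsi_cont : Continuous zbPsi := by unfold zbPsi; fun_prop

lemma zbPsi_Phi (p : ℝ × ℝ) (hp : 0 < p.2) : zbPsi (zbPhi p) = p := by
  ext
  · simp [zbPsi, zbPhi]
  · simp [zbPsi, zbPhi, Real.sqrt_sq hp.le]

lemma zbPhi_Psi (y : ℝ × ℝ) (hp : 0 < (zbPsi y).2) : zbPhi (zbPsi y) = y := by
  have h : 0 < y.1 - (y.2 - √2 * y.1) ^ 2 := Real.sqrt_pos.1 hp
  have e : √(y.1 - (y.2 - √2 * y.1) ^ 2) ^ 2 = y.1 - (y.2 - √2 * y.1) ^ 2 := Real.sq_sqrt h.le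
  ext
  · simp [zbPsi, zbPhi, e]
  · simp [zbPsi, zbPhi, e]

noncomputable def zbPhi' (p : ℝ × ℝ) : ℝ × ℝ →L[ℝ] ℝ × ℝ :=
  (Matrix.toLin (.finTwoProd ℝ) (.finTwoProd ℝ)
    !![2 * p.1, 2 * p.2; 1 + √2 * (2 * p.1), √2 * (2 * p.2)]).toContinuousLinearMap

lemma zbPhi'_has (p : ℝ × ℝ) : HasFDerivAt zbPhi (zbPhi' p) p := by
  unfold zbPhi'
  rw [Matrix.toLin_finTwoProd_toContinuousLinearMap]
  have h1 : HasFDerivAt (fun p : ℝ × ℝ => p.1) (ContinuousLinearMap.fst ℝ ℝ ℝ) p := hasFDerivAt_fst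
  have h2 : HasFDerivAt (fun p : ℝ × ℝ => p.2) (ContinuousLinearMap.snd ℝ ℝ ℝ) p := hasFDerivAt_snd
  have h3 := (h1.pow 2).add (h2.pow 2)
  have h4 : HasFDerivAt zbPhi _ p := h3.prodMk (h1.add (h3.const_mul √2))
  convert! h4 using 1
  ext <;> simp

lemma zbPhi'_det (p : ℝ × ℝ) : (zbPhi' p).det = - (2 * p.2) := by
  unfold zbPhi'
  simp only [LinearMap.det_toContinuousLinearMap, LinearMap.det_toLin, Matrix.det_fin_two_of]
  ring

lemma zb_cov (h : ℝ × ℝ → ℂ) (hs : ∀ p : ℝ × ℝ, p.2 ≤ 0 → h p = 0) :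
    ∫ y, h (zbPsi y) = ∫ p : ℝ × ℝ, ((2 * p.2 : ℝ) : ℂ) * h p := by
  have hm : MeasurableSet {p : ℝ × ℝ | 0 < p.2} := measurableSet_lt measurable_const measurable_snd
  have inj : Set.InjOn zbPhi {p : ℝ × ℝ | 0 < p.2} := by
    intro p hp q hq hpq
    rw [← zbPsi_Phi p hp, ← zbPsi_Phi q hq, hpq]
  have := integral_image_eq_integral_abs_det_fderiv_smul (volume : Measure (ℝ × ℝ)) hm
    (fun p _ => (zbPhi'_has p).hasFDerivWithinAt) inj (fun y => h (zbPsi y))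
  rw [setIntegral_eq_integral_of_forall_compl_eq_zero] at this
  · rw [this, ← setIntegral_eq_integral_of_forall_compl_eq_zero
      (s := {p : ℝ × ℝ | 0 < p.2}) (f := fun p : ℝ × ℝ => ((2 * p.2 : ℝ) : ℂ) * h p)]
    · apply setIntegral_congr_fun hm
      intro p hp
      have hp' : 0 < p.2 := hp
      simp only
      rw [zbPsi_Phi p hp, zbPhi'_det, abs_neg, abs_of_pos (by positivity), Complex.real_smul]
    · intro p hp
      rw [hs p (not_lt.1 hp), mul_zero]
  · intro y hy
    apply hs
    by_contra hc
    exact hy ⟨zbPsi y, not_le.1 hc, zbPhi_Psi y (not_le.1 hc)⟩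

/-- quadrature weight -/
noncomputable def zbOm (φ : ℝ × ℝ → ℝ) (y : ℝ × ℝ) : ℝ := (zbPsi y).2⁻¹ * φ (zbPsi y) / 2

lemma zb_face {φ : ℝ × ℝ → ℝ} (hφ : ZbD φ) : ∃ C, 0 ≤ C ∧ ∀ M : ℕ, 0 < M → ∀ a b c : ℝ,
    |a| ≤ 30 → |b| ≤ 30 → |c| ≤ 30 →
    |((M:ℝ) ^ 2)⁻¹ * ∑ i : Fin M, ∑ j : Fin M,
      |a * (zbPsi (((i:ℕ) + 1 : ℝ) / M, ((j:ℕ) + 1 : ℝ) / M)).1 +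
        b * (zbPsi (((i:ℕ) + 1 : ℝ) / M, ((j:ℕ) + 1 : ℝ) / M)).2 + c| *
        zbOm φ (((i:ℕ) + 1 : ℝ) / M, ((j:ℕ) + 1 : ℝ) / M)
      - ∫ p : ℝ × ℝ, |a * p.1 + b * p.2 + c| * φ p| ≤ C * (M:ℝ) ^ (-(5/2:ℝ)) := by
  obtain ⟨C, hC, H⟩ := zbc_bound hφ
  refine ⟨∑' k, C * zbBeta k, tsum_nonneg fun k => mul_nonneg hC (zbBeta_nonneg k), ?_⟩
  intro M hM a b c ha hb hc
  set g : ℝ × ℝ → ℝ := fun p => |a * p.1 + b * p.2 + c| * (p.2⁻¹ * φ p / 2) with hg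
  have hinv := zbMul_inv φ hφ
  have gs : ∀ p, p ∉ zbBox → g p = 0 := by
    intro p hp; simp [hg, hφ.supp p hp]
  have gc : Continuous g := by
    have := hinv.smooth.continuous
    simp only [hg]
    fun_prop
  set G : ℝ × ℝ → ℂ := fun y => (g (zbPsi y) : ℂ) with hG
  have Gc : Continuous G := Complex.continuous_ofReal.comp (gc.comp zbPsi_cont)
  have bp : ∀ p ∈ zbBox, 0 < p.2 := fun p hp => lt_of_lt_of_le (by norm_num) hp.2.1
  have Gs : ∀ p : ℝ × ℝ, p ∉ Set.Icc (1/200:ℝ) (1 - 1/200) ×ˢ Set.Icc (1/200:ℝ) (1 - 1/200) → G p = 0 := by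
    intro y hy
    simp only [hG]
    rw [gs, Complex.ofReal_zero]
    intro hb
    apply hy
    have h2 := zbPhi_Psi y (bp _ hb)
    obtain ⟨⟨b1, b2⟩, ⟨b3, b4⟩⟩ := hb
    set p := zbPsi y
    rw [← h2]
    have s3 : √2 ≤ (3/2:ℝ) := by
      rw [Real.sqrt_le_iff]; norm_num
    have s4 : 0 ≤ √2 := Real.sqrt_nonneg 2
    have q1 : p.1 ^ 2 ≤ (7/20) ^ 2 := by nlinarith
    have q2 : p.2 ^ 2 ≤ (7/20) ^ 2 := by nlinarith
    have q3 : (1/20) ^ 2 ≤ p.1 ^ 2 := by nlinarith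
    have q4 : (1/20) ^ 2 ≤ p.2 ^ 2 := by nlinarith
    have q5 : √2 * (p.1 ^ 2 + p.2 ^ 2) ≤ 3/2 * (p.1 ^ 2 + p.2 ^ 2) := by gcongr
    have q6 : 0 ≤ √2 * (p.1 ^ 2 + p.2 ^ 2) := by positivity
    simp only [zbPhi]
    refine ⟨⟨?_, ?_⟩, ⟨?_, ?_⟩⟩ <;> simp only <;> linarith
  have hat : ∀ k, zbHat G k = zbc a b c (-(2 * Real.pi) * k 1) (-(2 * Real.pi) * (k 0 + √2 * k 1))
      (fun x => |x|) φ := by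
    intro k
    set h : ℝ × ℝ → ℂ := fun p => Complex.exp (-2 * Real.pi * Complex.I *
      (k 0 * (zbPhi p).1 + k 1 * (zbPhi p).2)) * g p with hh
    have e1 : zbHat G k = ∫ y, h (zbPsi y) := by
      rw [zbHat]
      congr 1
      funext y
      simp only [hh, hG]
      by_cases hb : zbPsi y ∈ zbBox
      · rw [zbPhi_Psi y (bp _ hb)]
      · rw [gs _ hb]; simp
    rw [e1, zb_cov h, zbc]
    · congr 1
      funext p
      by_cases hb : p ∈ zbBox
      · have h0 := bp p hb
        have : 2 * p.2 * g p = |a * p.1 + b * p.2 + c| * φ p := by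
          simp only [hg]; field_simp
        rw [← this]
        simp only [hh, zbE, zbPhi]
        push_cast
        have e3 : (-2 * Real.pi * Complex.I * (k 0 * (p.1 ^ 2 + p.2 ^ 2) + k 1 *
          (p.1 + (√2 : ℝ) * (p.1 ^ 2 + p.2 ^ 2))) : ℂ) = Complex.I * (-(2 * Real.pi) * k 1 * p.1 + 0 * p.2 +
          -(2 * Real.pi) * (k 0 + (√2 : ℝ) * k 1) * (p.1 ^ 2 + p.2 ^ 2)) := by ring
        rw [e3]; ring
      · simp [hh, gs p hb, hφ.supp p hb]
    · intro p hp
      have : p ∉ zbBox := fun hb => absurd (bp p hb) (not_lt.2 hp)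
      simp [hh, gs p this]
  have hk : ∀ k, k ≠ 0 → ‖zbHat G k‖ ≤ C * zbBeta k := by
    intro k hk
    have hne : k 0 ≠ 0 ∨ k 1 ≠ 0 := by
      by_contra hcon
      push Not at hcon
      apply hk; funext i; fin_cases i
      · exact hcon.1
      · exact hcon.2
    have hτ := zbTau_ne (k 0) (k 1) hne
    have hpi : 1 ≤ 2 * Real.pi := by linarith [Real.pi_gt_three]
    have hb := H a b c (-(2 * Real.pi) * k 1) (-(2 * Real.pi) * (k 0 + √2 * k 1))
      (mul_ne_zero (by linarith) hτ) ha hb hc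
    rw [← hat] at hb
    set τ := (k 0 + √2 * k 1 : ℝ)
    have hp : 0 < (k 1 : ℝ) ^ 2 + τ ^ 2 := by positivity
    have hsq : 0 < √|τ| := Real.sqrt_pos.2 (abs_pos.2 hτ)
    have l1 : (k 1 : ℝ) ^ 2 + τ ^ 2 ≤ (-(2 * Real.pi) * k 1) ^ 2 + (-(2 * Real.pi) * τ) ^ 2 := by
      have : (1:ℝ) ≤ (2 * Real.pi) ^ 2 := by nlinarith
      nlinarith
    have l2 : √|τ| ≤ √|(-(2 * Real.pi) * τ)| := by
      apply Real.sqrt_le_sqrt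
      rw [abs_mul, abs_neg, abs_of_pos (by positivity : (0:ℝ) < 2 * Real.pi)]
      nlinarith [abs_nonneg τ]
    have l3 : ((k 1 : ℝ) ^ 2 + τ ^ 2) * ‖zbHat G k‖ ≤ C / √|τ| := by
      calc _ ≤ _ := mul_le_mul_of_nonneg_right l1 (norm_nonneg _)
        _ ≤ _ := hb
        _ ≤ _ := by gcongr
    rw [zbBeta, mul_one_div, le_div_iff₀ (by positivity)]
    rw [le_div_iff₀ hsq] at l3
    linarith
  have main := zb_quad (fun k => C * zbBeta k) (zbBeta_summable.mul_left C)
    (fun k => mul_nonneg hC (zbBeta_nonneg k)) (fun M k hM => by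
      have := mul_le_mul_of_nonneg_left (zbBeta_scale M k hM) hC
      linarith) G Gc (1/200) (by norm_num) Gs hk M hM
  have h0 : zbHat G 0 = ((∫ p : ℝ × ℝ, |a * p.1 + b * p.2 + c| * φ p : ℝ) : ℂ) := by
    rw [hat, zbc, ← integral_complex_ofReal]
    congr 1
    funext p
    simp [zbE]
  rw [h0] at main
  rw [mul_comm ((M:ℝ) ^ (-(5/2:ℝ)))] at main
  refine le_trans (le_of_eq ?_) main
  rw [← Real.norm_eq_abs, ← Complex.norm_real]
  congr 1
  push_cast
  congr 1
  simp [hG, hg, zbOm]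


abbrev ZbV := EuclideanSpace ℝ (Fin 3)

/-- coordinates -/
noncomputable def zbTh : ZbV ≃ᵐ ℝ × (ℝ × ℝ) :=
  ((MeasurableEquiv.toLp 2 (Fin 3 → ℝ)).symm.trans
    (MeasurableEquiv.piFinSuccAbove (fun _ : Fin 3 => ℝ) 2)).trans
    (MeasurableEquiv.prodCongr (MeasurableEquiv.refl ℝ) MeasurableEquiv.finTwoArrow)

lemma zbTh_apply (x : ZbV) : zbTh x = (x 2, (x 0, x 1)) := rfl

lemma zbTh_mp : MeasurePreserving zbTh volume volume := by
  have h1 := EuclideanSpace.volume_preserving_symm_measurableEquiv_toLp (Fin 3)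
  have h2 := volume_preserving_piFinSuccAbove (fun _ : Fin 3 => ℝ) 2
  have h3 : MeasurePreserving (MeasurableEquiv.prodCongr (MeasurableEquiv.refl ℝ)
      (MeasurableEquiv.finTwoArrow (α := ℝ))) volume volume :=
    (MeasurePreserving.id volume).prod (volume_preserving_finTwoArrow ℝ)
  exact h3.comp (h2.comp h1)

lemma zb_integral_coord (F : ℝ × (ℝ × ℝ) → ℝ) :
    ∫ x : ZbV, F (x 2, (x 0, x 1)) = ∫ q, F q := by
  rw [← zbTh_mp.integral_comp' (g := F)]
  rfl

lemma zb_normsq (x : ZbV) : ‖x‖ ^ 2 = x 0 ^ 2 + x 1 ^ 2 + x 2 ^ 2 := by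
  rw [EuclideanSpace.norm_sq_eq]
  simp [Fin.sum_univ_three]

lemma zb_inner (x y : ZbV) : inner ℝ x y = x 0 * y 0 + x 1 * y 1 + x 2 * y 2 := by
  rw [PiLp.inner_apply]
  simp [Fin.sum_univ_three]
  ring

lemma zb_half3 (b : ℝ) (hb : 0 < b) : ∫ x in Set.Ioi (0:ℝ), x ^ 3 * Real.exp (-b * x ^ 2) = 1 / (2 * b ^ 2) := by
  have := integral_rpow_mul_exp_neg_mul_rpow (p := 2) (q := 3) (b := b) (by norm_num) (by norm_num) hb
  have e : ((3:ℝ) + 1) / 2 = 2 := by norm_num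
  have e2 : (-((3:ℝ) + 1) / 2) = -2 := by norm_num
  rw [e, e2, Real.Gamma_two, Real.rpow_neg hb.le] at this
  norm_cast at this
  rw [this]
  field_simp

lemma zb_half1 (b : ℝ) (hb : 0 < b) : ∫ x in Set.Ioi (0:ℝ), x * Real.exp (-b * x ^ 2) = 1 / (2 * b) := by
  have := integral_rpow_mul_exp_neg_mul_rpow (p := 2) (q := 1) (b := b) (by norm_num) (by norm_num) hb
  have e : ((1:ℝ) + 1) / 2 = 1 := by norm_num
  have e2 : (-((1:ℝ) + 1) / 2) = -1 := by norm_num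
  rw [e, e2, Real.Gamma_one, Real.rpow_neg hb.le] at this
  norm_cast at this
  simp only [pow_one] at this
  rw [this]
  field_simp

lemma zb_full3 (b : ℝ) (hb : 0 < b) : ∫ x : ℝ, |x| ^ 3 * Real.exp (-b * x ^ 2) = 1 / b ^ 2 := by
  have := integral_comp_abs (f := fun x => x ^ 3 * Real.exp (-b * x ^ 2))
  simp only [sq_abs] at this
  rw [this, zb_half3 b hb]
  field_simp

lemma zb_full1 : ∫ x : ℝ, |x| * Real.exp (-x ^ 2) = 1 := by
  have := integral_comp_abs (f := fun x => x * Real.exp (-(1:ℝ) * x ^ 2))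
  simp only [sq_abs] at this
  rw [zb_half1 1 one_pos] at this
  convert! this using 1
  · congr 1; funext x; congr 2; ring
  · norm_num

/-- first Gaussian moment -/
lemma zb_I1 (c : ZbV) : ∫ x : ZbV, |inner ℝ c x| * Real.exp (-‖x‖ ^ 2) = ‖c‖ * Real.pi := by
  set e : ZbV := EuclideanSpace.single 2 1 with he
  have hen : ‖e‖ = 1 := by simp [he]
  set w : ZbV := ‖c‖ • e with hw
  have hcw : ‖c‖ = ‖w‖ := by rw [hw, norm_smul, hen]; simp
  set R := Submodule.reflection (ℝ ∙ (c - w))ᗮ with hR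
  have hRc : R c = w := Submodule.reflection_sub hcw
  have h1 : ∫ x : ZbV, |inner ℝ c x| * Real.exp (-‖x‖ ^ 2) =
      ∫ x : ZbV, |inner ℝ w x| * Real.exp (-‖x‖ ^ 2) := by
    rw [← (R.measurePreserving).integral_comp R.toHomeomorph.measurableEmbedding
      (fun x : ZbV => |inner ℝ w x| * Real.exp (-‖x‖ ^ 2))]
    congr 1
    funext x
    rw [← hRc, R.inner_map_map, R.norm_map]
  rw [h1]
  have h2 : ∀ x : ZbV, |inner ℝ w x| * Real.exp (-‖x‖ ^ 2) = ‖c‖ * ((fun q : ℝ × (ℝ × ℝ) =>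
      (|q.1| * Real.exp (-q.1 ^ 2)) * (Real.exp (-1 * q.2.1 ^ 2) * Real.exp (-1 * q.2.2 ^ 2))) (x 2, (x 0, x 1))) := by
    intro x
    have : inner ℝ w x = ‖c‖ * x 2 := by
      rw [zb_inner, hw, he]; simp
    rw [this, abs_mul, abs_norm, zb_normsq, mul_assoc]
    congr 1
    simp only
    rw [mul_assoc, ← Real.exp_add, ← Real.exp_add]
    congr 2
    ring
  rw [integral_congr_ae (Filter.Eventually.of_forall h2), integral_const_mul]
  congr 1
  refine (zb_integral_coord (fun q : ℝ × (ℝ × ℝ) => (|q.1| * Real.exp (-q.1 ^ 2)) *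
    (Real.exp (-1 * q.2.1 ^ 2) * Real.exp (-1 * q.2.2 ^ 2)))).trans ?_
  rw [Measure.volume_eq_prod, integral_prod_mul (fun z : ℝ => |z| * Real.exp (-z ^ 2))
    (fun p : ℝ × ℝ => Real.exp (-1 * p.1 ^ 2) * Real.exp (-1 * p.2 ^ 2)), zb_full1,
    Measure.volume_eq_prod, integral_prod_mul (fun z : ℝ => Real.exp (-1 * z ^ 2))
    (fun z : ℝ => Real.exp (-1 * z ^ 2)), integral_gaussian, one_mul, div_one,
    Real.mul_self_sqrt Real.pi_pos.le]

lemma zb_I2 : ∫ x : ZbV, ‖x‖ * Real.exp (-‖x‖ ^ 2) = 2 * Real.pi := by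
  rw [integral_fun_norm_addHaar volume (fun r => r * Real.exp (-r ^ 2))]
  have h := zb_half3 1 one_pos
  have e : ∫ y in Set.Ioi (0:ℝ), y ^ (Module.finrank ℝ ZbV - 1) • (y * Real.exp (-y ^ 2)) = 1 / 2 := by
    rw [finrank_euclideanSpace_fin]
    rw [show (1/2:ℝ) = 1 / (2 * 1 ^ 2) by norm_num, ← h]
    congr 1; funext y; simp; ring
  rw [e, Measure.real, EuclideanSpace.volume_ball_fin_three, finrank_euclideanSpace_fin]
  have := Real.pi_pos
  simp [ENNReal.toReal_ofReal (show 0 ≤ Real.pi * 4 / 3 by positivity)]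
  ring

lemma zb_I2_int : Integrable (fun x : ZbV => ‖x‖ * Real.exp (-‖x‖ ^ 2)) := by
  rw [integrable_fun_norm_addHaar volume (f := fun r => r * Real.exp (-r ^ 2))]
  have h := integrableOn_rpow_mul_exp_neg_mul_sq (b := 1) one_pos (s := 3) (by norm_num)
  rw [finrank_euclideanSpace_fin]
  refine h.congr_fun ?_ measurableSet_Ioi
  intro y hy
  simp
  ring

lemma zb_I1_int (c : ZbV) : Integrable (fun x : ZbV => |inner ℝ c x| * Real.exp (-‖x‖ ^ 2)) := by
  refine (zb_I2_int.const_mul ‖c‖).mono' (by fun_prop) ?_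
  refine Filter.Eventually.of_forall fun x => ?_
  rw [Real.norm_eq_abs, abs_mul, abs_abs, Real.abs_exp, ← mul_assoc]
  gcongr
  exact abs_real_inner_le_norm c x


noncomputable def zbq (s a : ℝ) : ℝ := expNegInvGlue (a ^ 2 / s - 1 / 6)

/-- partition of unity, homogeneous of degree zero -/
noncomputable def zbW (x y z : ℝ) : ℝ :=
  zbq (x ^ 2 + y ^ 2 + z ^ 2) z / (zbq (x ^ 2 + y ^ 2 + z ^ 2) x + zbq (x ^ 2 + y ^ 2 + z ^ 2) y +
    zbq (x ^ 2 + y ^ 2 + z ^ 2) z)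

lemma zbq_nonneg (s a : ℝ) : 0 ≤ zbq s a := expNegInvGlue.nonneg _

lemma zbW_nonneg (x y z : ℝ) : 0 ≤ zbW x y z := by
  unfold zbW
  have := zbq_nonneg (x ^ 2 + y ^ 2 + z ^ 2)
  exact div_nonneg (this z) (by linarith [this x, this y, this z])

lemma zbW_le (x y z : ℝ) : zbW x y z ≤ 1 := by
  unfold zbW
  have := zbq_nonneg (x ^ 2 + y ^ 2 + z ^ 2)
  exact div_le_one_of_le₀ (by linarith [this x, this y, this z]) (by linarith [this x, this y, this z])

lemma zbq_den (x y z : ℝ) (h : 0 < x ^ 2 + y ^ 2 + z ^ 2) :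
    0 < zbq (x ^ 2 + y ^ 2 + z ^ 2) x + zbq (x ^ 2 + y ^ 2 + z ^ 2) y +
    zbq (x ^ 2 + y ^ 2 + z ^ 2) z := by
  have n := zbq_nonneg (x ^ 2 + y ^ 2 + z ^ 2)
  set s := x ^ 2 + y ^ 2 + z ^ 2 with hs
  have key : ∀ a, s ≤ 3 * a ^ 2 → 0 < zbq s a := by
    intro a ha
    apply expNegInvGlue.pos_of_pos
    have : 1 / 3 ≤ a ^ 2 / s := by
      rw [le_div_iff₀ h]; linarith
    linarith
  by_cases h1 : s ≤ 3 * x ^ 2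
  · linarith [key x h1, n y, n z]
  by_cases h2 : s ≤ 3 * y ^ 2
  · linarith [key y h2, n x, n z]
  have h3 : s ≤ 3 * z ^ 2 := by linarith
  linarith [key z h3, n x, n y]

lemma zbW_sum (x y z : ℝ) (h : 0 < x ^ 2 + y ^ 2 + z ^ 2) :
    zbW x y z + zbW y z x + zbW z x y = 1 := by
  have d := zbq_den x y z h
  unfold zbW
  rw [show y ^ 2 + z ^ 2 + x ^ 2 = x ^ 2 + y ^ 2 + z ^ 2 by ring,
    show z ^ 2 + x ^ 2 + y ^ 2 = x ^ 2 + y ^ 2 + z ^ 2 by ring]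
  set s := x ^ 2 + y ^ 2 + z ^ 2
  rw [show zbq s y + zbq s z + zbq s x = zbq s x + zbq s y + zbq s z by ring,
    show zbq s z + zbq s x + zbq s y = zbq s x + zbq s y + zbq s z by ring]
  field_simp
  ring

lemma zbW_hom (x y z : ℝ) (hz : z ≠ 0) : zbW (z * x) (z * y) z = zbW x y 1 := by
  unfold zbW
  have e : (z * x) ^ 2 + (z * y) ^ 2 + z ^ 2 = z ^ 2 * (x ^ 2 + y ^ 2 + 1 ^ 2) := by ring
  have k : ∀ a, zbq (z ^ 2 * (x ^ 2 + y ^ 2 + 1 ^ 2)) (z * a) = zbq (x ^ 2 + y ^ 2 + 1 ^ 2) a := by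
    intro a
    unfold zbq
    congr 2
    rw [mul_pow, mul_div_mul_left _ _ (by positivity)]
  have k1 := k 1
  rw [mul_one] at k1
  rw [e, k, k, k1]

lemma zbW_supp (x y : ℝ) (h : 9 < x ^ 2 ∨ 9 < y ^ 2) : zbW x y 1 = 0 := by
  unfold zbW
  have : zbq (x ^ 2 + y ^ 2 + 1 ^ 2) 1 = 0 := by
    apply expNegInvGlue.zero_of_nonpos
    have : (1:ℝ) ^ 2 / (x ^ 2 + y ^ 2 + 1 ^ 2) ≤ 1 / 6 := by
      rw [div_le_div_iff₀ (by positivity) (by norm_num)]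
      rcases h with h | h <;> nlinarith [sq_nonneg x, sq_nonneg y]
    linarith
  rw [this, zero_div]

lemma zbW_smooth : ContDiff ℝ ∞ (fun p : ℝ × ℝ => zbW p.1 p.2 1) := by
  have q : ∀ f : ℝ × ℝ → ℝ, ContDiff ℝ ∞ f →
      ContDiff ℝ ∞ (fun p : ℝ × ℝ => zbq (p.1 ^ 2 + p.2 ^ 2 + 1 ^ 2) (f p)) := by
    intro f hf
    unfold zbq
    refine expNegInvGlue.contDiff.comp ?_
    refine ContDiff.sub (ContDiff.div (by fun_prop) (by fun_prop) ?_) contDiff_const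
    intro p; positivity
  unfold zbW
  refine ContDiff.div (q (fun _ => 1) contDiff_const) (((q _ contDiff_fst).add (q _ contDiff_snd)).add
    (q (fun _ => 1) contDiff_const)) ?_
  intro p
  exact (zbq_den p.1 p.2 1 (by positivity)).ne'

lemma zbq_meas : Measurable (fun p : ℝ × ℝ => zbq p.1 p.2) := by
  unfold zbq
  have : Continuous expNegInvGlue := expNegInvGlue.contDiff (n := 0) |>.continuous
  exact this.measurable.comp (by fun_prop)

lemma zbW_meas : Measurable (fun p : ℝ × (ℝ × ℝ) => zbW p.2.1 p.2.2 p.1) := by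
  unfold zbW
  have q : ∀ f : ℝ × (ℝ × ℝ) → ℝ, Measurable f →
     Measurable (fun p : ℝ × (ℝ × ℝ) => zbq (p.2.1 ^ 2 + p.2.2 ^ 2 + p.1 ^ 2) (f p)) := by
    intro f hf
    exact zbq_meas.comp (Measurable.prodMk (by fun_prop) hf)
  refine Measurable.div (q _ (by fun_prop)) (((q _ ?_).add (q _ ?_)).add (q _ ?_)) <;> fun_prop

noncomputable def zbw (p : ℝ × ℝ) : ℝ :=
  400 * (zbW (20 * p.1 - 4) (20 * p.2 - 4) 1 / (1 + (20 * p.1 - 4) ^ 2 + (20 * p.2 - 4) ^ 2) ^ 2)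

lemma zbw_nonneg (p : ℝ × ℝ) : 0 ≤ zbw p := by
  have := zbW_nonneg (20 * p.1 - 4) (20 * p.2 - 4) 1
  unfold zbw; positivity

lemma zbw_D : ZbD zbw := by
  constructor
  · unfold zbw
    refine contDiff_const.mul (ContDiff.div ?_ (by fun_prop) ?_)
    · exact zbW_smooth.comp (g := fun p : ℝ × ℝ => zbW p.1 p.2 1)
        (f := fun p : ℝ × ℝ => (20 * p.1 - 4, 20 * p.2 - 4)) (by fun_prop)
    · intro p; positivity
  · intro p hp
    unfold zbw
    rw [zbW_supp]
    · simp
    by_contra hc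
    push Not at hc
    apply hp
    have h1 := abs_le_of_sq_le_sq (show (20 * p.1 - 4) ^ 2 ≤ 3 ^ 2 by linarith) (by norm_num)
    have h2 := abs_le_of_sq_le_sq (show (20 * p.2 - 4) ^ 2 ≤ 3 ^ 2 by linarith) (by norm_num)
    rw [abs_le] at h1 h2
    refine ⟨⟨?_, ?_⟩, ⟨?_, ?_⟩⟩ <;> linarith

/-- face integral in affine coordinates -/
noncomputable def zbJ (a b c : ℝ) : ℝ :=
  ∫ p : ℝ × ℝ, |a * p.1 + b * p.2 + c| * (zbW p.1 p.2 1 / (1 + p.1 ^ 2 + p.2 ^ 2) ^ 2)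

lemma zbJ_affine (a b c : ℝ) :
    ∫ p : ℝ × ℝ, |20 * a * p.1 + 20 * b * p.2 + (c - 4 * a - 4 * b)| * zbw p = zbJ a b c := by
  unfold zbJ
  set F : ℝ × ℝ → ℝ := fun p => |a * p.1 + b * p.2 + c| * (zbW p.1 p.2 1 / (1 + p.1 ^ 2 + p.2 ^ 2) ^ 2)
    with hF
  have h1 := Measure.integral_comp_smul (volume : Measure (ℝ × ℝ)) (fun p => F (p - (4, 4))) 20
  rw [integral_sub_right_eq_self F] at h1
  have h2 : ∀ p : ℝ × ℝ, |20 * a * p.1 + 20 * b * p.2 + (c - 4 * a - 4 * b)| * zbw p =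
      400 * F ((20:ℝ) • p - (4, 4)) := by
    intro p
    simp only [hF, zbw, Prod.fst_sub, Prod.snd_sub, Prod.smul_fst, Prod.smul_snd, smul_eq_mul]
    rw [show 20 * a * p.1 + 20 * b * p.2 + (c - 4 * a - 4 * b) =
      a * (20 * p.1 - 4) + b * (20 * p.2 - 4) + c by ring]
    ring
  rw [integral_congr_ae (Filter.Eventually.of_forall h2), integral_const_mul, h1]
  simp only [Module.finrank_prod, Module.finrank_self, smul_eq_mul]
  rw [← mul_assoc, show (400:ℝ) * |((20:ℝ) ^ (1 + 1))⁻¹| = 1 by norm_num, one_mul]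

lemma zbG_int (c : ZbV) : Integrable (fun q : ℝ × (ℝ × ℝ) => zbW q.2.1 q.2.2 q.1 *
    (|c 0 * q.2.1 + c 1 * q.2.2 + c 2 * q.1| * Real.exp (-(q.2.1 ^ 2 + q.2.2 ^ 2 + q.1 ^ 2)))) := by
  rw [← zbTh_mp.integrable_comp_emb zbTh.measurableEmbedding]
  refine (zb_I1_int c).mono' ?_ ?_
  · refine (Measurable.comp ?_ zbTh.measurable).aestronglyMeasurable
    exact zbW_meas.mul (by fun_prop)
  · refine Filter.Eventually.of_forall fun x => ?_
    simp only [Function.comp, zbTh_apply]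
    have e1 := zb_inner c x
    have e2 := zb_normsq x
    rw [← e1, ← e2, norm_mul, Real.norm_of_nonneg (zbW_nonneg _ _ _), Real.norm_of_nonneg (by positivity)]
    exact mul_le_of_le_one_left (by positivity) (zbW_le _ _ _)

lemma zb_abs3_int : Integrable (fun z : ℝ => |z| ^ 3 * Real.exp (-1 * z ^ 2)) := by
  have h := integrable_rpow_mul_exp_neg_mul_sq (b := 1) one_pos (s := 3) (by norm_num)
  have := h.norm
  refine this.congr (Filter.Eventually.of_forall fun z => ?_)
  simp only [norm_mul, Real.norm_eq_abs, Real.abs_exp]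
  congr 1
  rw [show (3:ℝ) = ((3:ℕ):ℝ) by norm_num, Real.rpow_natCast, abs_pow]

lemma zbWl_int (a b c : ℝ) : Integrable (fun p : ℝ × ℝ => zbW p.1 p.2 1 * |a * p.1 + b * p.2 + c|) := by
  refine Continuous.integrable_of_hasCompactSupport (zbW_smooth.continuous.mul (by fun_prop)) ?_
  refine HasCompactSupport.intro (K := Set.Icc (-3) 3 ×ˢ Set.Icc (-3) 3) (isCompact_Icc.prod isCompact_Icc) ?_
  intro p hp
  rw [zbW_supp, zero_mul]
  by_contra hc
  push Not at hc
  apply hp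
  have h1 := abs_le_of_sq_le_sq (show (p.1) ^ 2 ≤ 3 ^ 2 by linarith) (by norm_num)
  have h2 := abs_le_of_sq_le_sq (show (p.2) ^ 2 ≤ 3 ^ 2 by linarith) (by norm_num)
  rw [abs_le] at h1 h2
  exact ⟨h1, h2⟩

lemma zb_face_id (c : ZbV) : ∫ x : ZbV, zbW (x 0) (x 1) (x 2) * (|inner ℝ c x| * Real.exp (-‖x‖ ^ 2))
    = zbJ (c 0) (c 1) (c 2) := by
  set G : ℝ × (ℝ × ℝ) → ℝ := fun q => zbW q.2.1 q.2.2 q.1 *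
    (|c 0 * q.2.1 + c 1 * q.2.2 + c 2 * q.1| * Real.exp (-(q.2.1 ^ 2 + q.2.2 ^ 2 + q.1 ^ 2))) with hG
  set H : ℝ → ℝ × ℝ → ℝ := fun z p => zbW p.1 p.2 1 * |c 0 * p.1 + c 1 * p.2 + c 2| *
    (|z| ^ 3 * Real.exp (-(1 + p.1 ^ 2 + p.2 ^ 2) * z ^ 2)) with hH
  have h1 : ∫ x : ZbV, zbW (x 0) (x 1) (x 2) * (|inner ℝ c x| * Real.exp (-‖x‖ ^ 2)) = ∫ q, G q := by
    rw [← zb_integral_coord]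
    congr 1; funext x
    simp only [hG]
    rw [zb_inner, zb_normsq]
  have h2 : ∫ q, G q = ∫ z : ℝ, ∫ p : ℝ × ℝ, H z p := by
    rw [Measure.volume_eq_prod, integral_prod _ (zbG_int c)]
    refine integral_congr_ae ?_
    filter_upwards [Measure.ae_ne volume (0:ℝ)] with z hz
    have h3 := Measure.integral_comp_smul (volume : Measure (ℝ × ℝ)) (fun p => G (z, p)) z
    have hz2 : 0 < z ^ 2 := by positivity
    have h4 : ∫ p : ℝ × ℝ, G (z, p) = z ^ 2 * ∫ p : ℝ × ℝ, G (z, z • p) := by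
      rw [h3]
      simp
      field_simp
    rw [h4, ← integral_const_mul]
    congr 1; funext p
    simp only [hG, hH, Prod.smul_fst, Prod.smul_snd, smul_eq_mul]
    rw [zbW_hom _ _ _ hz, show c 0 * (z * p.1) + c 1 * (z * p.2) + c 2 * z =
      z * (c 0 * p.1 + c 1 * p.2 + c 2) by ring, abs_mul,
      show -((z * p.1) ^ 2 + (z * p.2) ^ 2 + z ^ 2) = -(1 + p.1 ^ 2 + p.2 ^ 2) * z ^ 2 by ring,
      ← sq_abs z]
    ring
  have hintg : Integrable (Function.uncurry H) (volume.prod volume) := by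
    refine (zb_abs3_int.mul_prod (zbWl_int (c 0) (c 1) (c 2))).mono' ?_ ?_
    · refine Measurable.aestronglyMeasurable ?_
      have : Measurable (fun p : ℝ × (ℝ × ℝ) => zbW p.2.1 p.2.2 1) :=
        zbW_smooth.continuous.measurable.comp measurable_snd
      simp only [hH, Function.uncurry_def]
      exact (this.mul (by fun_prop)).mul (by fun_prop)
    · refine Filter.Eventually.of_forall fun q => ?_
      have := zbW_nonneg q.2.1 q.2.2 1
      simp only [hH, Function.uncurry_def]
      rw [Real.norm_of_nonneg (by positivity), mul_comm]
      gcongr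
      nlinarith [sq_nonneg q.1, sq_nonneg q.2.1, sq_nonneg q.2.2, mul_nonneg (sq_nonneg q.1) (sq_nonneg q.2.1), mul_nonneg (sq_nonneg q.1) (sq_nonneg q.2.2)]
  rw [h1, h2, integral_integral_swap hintg]
  unfold zbJ
  congr 1; funext p
  simp only [hH]
  rw [integral_const_mul, zb_full3 _ (by positivity)]
  ring

/-- cyclic coordinate shift -/
noncomputable def zbS : ZbV ≃ₗᵢ[ℝ] ZbV := LinearIsometryEquiv.piLpCongrLeft 2 ℝ ℝ (finRotate 3).symm

lemma zbS_apply (x : ZbV) : (zbS x) 0 = x 1 ∧ (zbS x) 1 = x 2 ∧ (zbS x) 2 = x 0 := by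
  refine ⟨?_, ?_, ?_⟩ <;> rfl

lemma zbS_int (F : ZbV → ℝ) : ∫ x, F (zbS x) = ∫ x, F x :=
  zbS.measurePreserving.integral_comp zbS.toHomeomorph.measurableEmbedding F

lemma zbW_int (c : ZbV) (f : ZbV → ℝ) (hf : Measurable f) (h0 : ∀ x, 0 ≤ f x) (h1 : ∀ x, f x ≤ 1) :
    Integrable (fun x => f x * (|inner ℝ c x| * Real.exp (-‖x‖ ^ 2))) := by
  refine (zb_I1_int c).mono' (hf.mul (by fun_prop)).aestronglyMeasurable ?_
  refine Filter.Eventually.of_forall fun x => ?_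
  rw [norm_mul, Real.norm_of_nonneg (h0 x), Real.norm_of_nonneg (by positivity)]
  exact mul_le_of_le_one_left (by positivity) (h1 x)

lemma zb_sum_faces (c : ZbV) :
    zbJ (c 0) (c 1) (c 2) + zbJ (c 1) (c 2) (c 0) + zbJ (c 2) (c 0) (c 1) = ‖c‖ * Real.pi := by
  have e1 := zb_face_id c
  have e2 := zb_face_id (zbS c)
  have e3 := zb_face_id (zbS (zbS c))
  rw [← zbS_int] at e2
  rw [← zbS_int, ← zbS_int] at e3
  simp only [zbS.inner_map_map, zbS.norm_map, (zbS_apply _).1, (zbS_apply _).2.1, (zbS_apply _).2.2] at e2 e3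
  have i0 : ∀ i j k : Fin 3, Integrable (fun x : ZbV => zbW (x i) (x j) (x k) *
      (|inner ℝ c x| * Real.exp (-‖x‖ ^ 2))) := fun i j k =>
    zbW_int c _ (zbW_meas.comp (g := fun p : ℝ × (ℝ × ℝ) => zbW p.2.1 p.2.2 p.1)
      (f := fun x : ZbV => (x k, (x i, x j))) (by fun_prop)) (fun x => zbW_nonneg _ _ _)
      (fun x => zbW_le _ _ _)
  have i1 := i0 0 1 2
  have i2 := i0 1 2 0
  have i3 := i0 2 0 1
  rw [← e1, ← e2, ← e3, ← zb_I1 c, ← integral_add, ← integral_add]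
  · refine integral_congr_ae ?_
    filter_upwards [Measure.ae_ne volume (0:ZbV)] with x hx
    have : 0 < ‖x‖ ^ 2 := by positivity
    rw [zb_normsq] at this
    rw [← add_mul, ← add_mul, zbW_sum _ _ _ this, one_mul]
  · exact i1.add i2
  · exact i3
  · exact i1
  · exact i2


lemma zb_coord_le (c : ZbV) (hc : ‖c‖ = 1) (i : Fin 3) : |c i| ≤ 1 := by
  have := PiLp.norm_apply_le c i
  rwa [hc] at this

/-- the raw quadrature -/
lemma zb_rawquad : ∃ C : ℝ, 0 ≤ C ∧ ∀ M : ℕ, 0 < M →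
    ∃ (wt : Fin 3 × Fin M × Fin M → ℝ) (p : Fin 3 × Fin M × Fin M → ZbV),
      (∀ i, 0 ≤ wt i) ∧ (∀ i, p i ≠ 0) ∧
      ∀ c : ZbV, ‖c‖ = 1 → |∑ i, wt i * |inner ℝ (p i) c| - Real.pi| ≤ C * (M:ℝ) ^ (-(5/2:ℝ)) := by
  obtain ⟨C, hC, hM⟩ := zb_face zbw_D
  refine ⟨3 * C, by positivity, fun M M0 => ?_⟩
  set Y : Fin M × Fin M → ℝ × ℝ := fun i => (((i.1:ℕ)+1:ℝ)/M, ((i.2:ℕ)+1:ℝ)/M) with hY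
  set X : Fin M × Fin M → ℝ × ℝ := fun i => zbPsi (Y i) with hX
  set w : Fin M × Fin M → ℝ := fun i => ((M:ℝ)^2)⁻¹ * zbOm zbw (Y i) with hw
  set P : Fin 3 → Fin M × Fin M → ZbV := fun k i =>
    if k = 0 then !₂[20 * (X i).1 - 4, 20 * (X i).2 - 4, 1] else
    if k = 1 then !₂[1, 20 * (X i).1 - 4, 20 * (X i).2 - 4] else
    !₂[20 * (X i).2 - 4, 1, 20 * (X i).1 - 4] with hP
  refine ⟨fun i => w i.2, fun i => P i.1 i.2, ?_, ?_, ?_⟩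
  · intro i
    have := zbw_nonneg (zbPsi (Y i.2))
    have h2 : 0 ≤ (zbPsi (Y i.2)).2 := by unfold zbPsi; positivity
    simp only [hw, zbOm]
    positivity
  · rintro ⟨k, i⟩ h
    simp only [hP] at h
    split_ifs at h
    · have := congrArg (fun x : ZbV => x 2) h
      simp at this
    · have := congrArg (fun x : ZbV => x 0) h
      simp at this
    · have := congrArg (fun x : ZbV => x 1) h
      simp at this
  · intro c hc
    have key : ∀ a b d : ℝ, |a| ≤ 1 → |b| ≤ 1 → |d| ≤ 1 →
        |∑ i : Fin M × Fin M, w i * |a * (20 * (X i).1 - 4) + b * (20 * (X i).2 - 4) + d| - zbJ a b d| ≤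
          C * (M:ℝ) ^ (-(5/2:ℝ)) := by
      intro a b d ha hb hd
      rw [abs_le] at ha hb hd
      have := hM M M0 (20 * a) (20 * b) (d - 4 * a - 4 * b) (by rw [abs_le]; constructor <;> linarith)
        (by rw [abs_le]; constructor <;> linarith) (by rw [abs_le]; constructor <;> linarith)
      rw [zbJ_affine] at this
      convert! this using 3
      rw [Fintype.sum_prod_type, Finset.mul_sum]
      refine Finset.sum_congr rfl fun i _ => ?_
      rw [Finset.mul_sum]
      refine Finset.sum_congr rfl fun j _ => ?_
      simp only [hw, hX, hY]
      rw [show ∀ u v : ℝ, a * (20 * u - 4) + b * (20 * v - 4) + d =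
        20 * a * u + 20 * b * v + (d - 4 * a - 4 * b) from fun u v => by ring]
      ring
    have l := zb_coord_le c hc
    have k1 := key (c 0) (c 1) (c 2) (l _) (l _) (l _)
    have k2 := key (c 1) (c 2) (c 0) (l _) (l _) (l _)
    have k3 := key (c 2) (c 0) (c 1) (l _) (l _) (l _)
    have hs := zb_sum_faces c
    rw [hc, one_mul] at hs
    rw [Fintype.sum_prod_type, Fin.sum_univ_three, ← hs]
    have e1 : ∀ i, |inner ℝ (P 0 i) c| = |c 0 * (20 * (X i).1 - 4) + c 1 * (20 * (X i).2 - 4) + c 2| := by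
      intro i; rw [zb_inner]; simp [hP]; congr 1; ring
    have e2 : ∀ i, |inner ℝ (P 1 i) c| = |c 1 * (20 * (X i).1 - 4) + c 2 * (20 * (X i).2 - 4) + c 0| := by
      intro i; rw [zb_inner]; simp [hP]; congr 1; ring
    have e3 : ∀ i, |inner ℝ (P 2 i) c| = |c 2 * (20 * (X i).1 - 4) + c 0 * (20 * (X i).2 - 4) + c 1| := by
      intro i; rw [zb_inner]; simp [hP]; congr 1; ring
    simp only [e1, e2, e3]
    rw [abs_le] at k1 k2 k3 ⊢
    constructor <;> linarith [k1.1, k1.2, k2.1, k2.2, k3.1, k3.2]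

/-- normalized quadrature -/
lemma zb_norm_quad {ι : Type} [Fintype ι] (wt : ι → ℝ) (p : ι → ZbV) (hwt : ∀ i, 0 ≤ wt i)
    (hp : ∀ i, p i ≠ 0) (ε : ℝ) (hε : ε ≤ 1)
    (h : ∀ c : ZbV, ‖c‖ = 1 → |∑ i, wt i * |inner ℝ (p i) c| - Real.pi| ≤ ε) :
    ∃ (v : ι → ZbV) (α : ι → ℝ), (∀ i, ‖v i‖ = 1) ∧ (∀ i, 0 ≤ α i) ∧ (∑ i, α i = 1) ∧
      ∀ c : ZbV, ‖c‖ = 1 → |(∑ i, α i * |inner ℝ (v i) c|) - 1 / 2| ≤ ε := by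
  have hpi := Real.pi_gt_three
  have hhom : ∀ c : ZbV, |∑ i, wt i * |inner ℝ (p i) c| - ‖c‖ * Real.pi| ≤ ε * ‖c‖ := by
    intro c
    by_cases hc : c = 0
    · subst hc; simp
    have hn : 0 < ‖c‖ := norm_pos_iff.2 hc
    have h1 := h (‖c‖⁻¹ • c) (by rw [norm_smul]; simp; field_simp)
    have e : ∑ i, wt i * |inner ℝ (p i) (‖c‖⁻¹ • c)| = ‖c‖⁻¹ * ∑ i, wt i * |inner ℝ (p i) c| := by
      rw [Finset.mul_sum]
      refine Finset.sum_congr rfl fun i _ => ?_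
      rw [inner_smul_right, abs_mul, abs_of_pos (inv_pos.2 hn)]
      ring
    rw [e] at h1
    have e2 : ∑ i, wt i * |inner ℝ (p i) c| - ‖c‖ * Real.pi =
       ‖c‖ * (‖c‖⁻¹ * (∑ i, wt i * |inner ℝ (p i) c|) - Real.pi) := by field_simp
    rw [e2, abs_mul, abs_norm, mul_comm]
    gcongr
  set S := ∑ i, wt i * ‖p i‖ with hS
  have hintg : ∀ i, Integrable (fun x : ZbV => wt i * (|inner ℝ (p i) x| * Real.exp (-‖x‖ ^ 2))) :=
    fun i => (zb_I1_int (p i)).const_mul _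
  have hSint : ∫ x : ZbV, ∑ i, wt i * (|inner ℝ (p i) x| * Real.exp (-‖x‖ ^ 2)) = S * Real.pi := by
    rw [integral_finsetSum _ (fun i _ => hintg i), hS, Finset.sum_mul]
    refine Finset.sum_congr rfl fun i _ => ?_
    rw [integral_const_mul, zb_I1, mul_assoc]
  have hSb : |S * Real.pi - Real.pi * (2 * Real.pi)| ≤ ε * (2 * Real.pi) := by
    rw [← hSint, ← zb_I2, ← integral_const_mul, ← integral_const_mul, ← integral_sub
      (integrable_finsetSum _ (fun i _ => hintg i)) (zb_I2_int.const_mul _), ← Real.norm_eq_abs]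
    refine norm_integral_le_of_norm_le (zb_I2_int.const_mul _) (Filter.Eventually.of_forall fun x => ?_)
    have e : ∑ i, wt i * (|inner ℝ (p i) x| * Real.exp (-‖x‖ ^ 2)) - Real.pi * (‖x‖ * Real.exp (-‖x‖ ^ 2)) =
      (∑ i, wt i * |inner ℝ (p i) x| - ‖x‖ * Real.pi) * Real.exp (-‖x‖ ^ 2) := by
      rw [sub_mul, Finset.sum_mul]
      congr 1
      · refine Finset.sum_congr rfl fun i _ => ?_
        ring
      · ring
    rw [e, norm_mul, Real.norm_eq_abs, Real.norm_eq_abs, Real.abs_exp, ← mul_assoc]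
    gcongr
    exact hhom x
  have hSb2 : |S - 2 * Real.pi| ≤ 2 * ε := by
    have e : S * Real.pi - Real.pi * (2 * Real.pi) = (S - 2 * Real.pi) * Real.pi := by ring
    rw [e, abs_mul, abs_of_pos Real.pi_pos] at hSb
    have : |S - 2 * Real.pi| * Real.pi ≤ 2 * ε * Real.pi := by linarith
    exact le_of_mul_le_mul_right this Real.pi_pos
  have hS3 : 2 ≤ S := by
    rw [abs_le] at hSb2; linarith [hSb2.1]
  have hS0 : 0 < S := by linarith
  refine ⟨fun i => ‖p i‖⁻¹ • p i, fun i => wt i * ‖p i‖ / S, ?_, ?_, ?_, ?_⟩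
  · intro i
    have := norm_pos_iff.2 (hp i)
    rw [norm_smul]; simp; field_simp
  · intro i
    have := hwt i
    positivity
  · rw [← Finset.sum_div, ← hS, div_self hS0.ne']
  · intro c hc
    have e : ∑ i, wt i * ‖p i‖ / S * |inner ℝ (‖p i‖⁻¹ • p i) c| = (∑ i, wt i * |inner ℝ (p i) c|) / S := by
      rw [Finset.sum_div]
      refine Finset.sum_congr rfl fun i _ => ?_
      have := norm_pos_iff.2 (hp i)
      rw [real_inner_smul_left, abs_mul, abs_of_pos (inv_pos.2 this)]
      field_simp
    rw [e]
    have h1 := h c hc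
    set T := ∑ i, wt i * |inner ℝ (p i) c|
    have e2 : T / S - 1 / 2 = ((T - Real.pi) - (S - 2 * Real.pi) / 2) / S := by field_simp; ring
    rw [e2, abs_div, abs_of_pos hS0, div_le_iff₀ hS0]
    rw [abs_le] at h1 hSb2 ⊢
    have h0 : 0 ≤ ε := by linarith
    constructor <;> nlinarith

/-- transport to `Fin n` with padding -/
lemma zb_pad {ι : Type} [Fintype ι] (n : ℕ) (hn : Fintype.card ι ≤ n) (v : ι → ZbV) (α : ι → ℝ)
    (hv : ∀ i, ‖v i‖ = 1) (hα : ∀ i, 0 ≤ α i) :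
    ∃ (v' : Fin n → ZbV) (α' : Fin n → ℝ), (∀ i, ‖v' i‖ = 1) ∧ (∀ i, 0 ≤ α' i) ∧
      (∑ i, α' i = ∑ i, α i) ∧ ∀ c : ZbV, ∑ i, α' i * |inner ℝ (v' i) c| = ∑ i, α i * |inner ℝ (v i) c| := by
  obtain ⟨f⟩ : Nonempty (ι ↪ Fin n) := Function.Embedding.nonempty_of_card_le (by simpa using hn)
  set e : ZbV := EuclideanSpace.single 2 1 with he
  have hen : ‖e‖ = 1 := by simp [he]
  refine ⟨Function.extend f v (fun _ => e), Function.extend f α (fun _ => 0), ?_, ?_, ?_, ?_⟩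
  · intro i
    by_cases hi : ∃ j, f j = i
    · obtain ⟨j, rfl⟩ := hi
      rw [f.injective.extend_apply]; exact hv j
    · rw [Function.extend_apply' _ _ _ hi]; exact hen
  · intro i
    by_cases hi : ∃ j, f j = i
    · obtain ⟨j, rfl⟩ := hi
      rw [f.injective.extend_apply]; exact hα j
    · rw [Function.extend_apply' _ _ _ hi]
  · refine (Fintype.sum_of_injective f f.injective _ _ ?_ ?_).symm
    · intro i hi
      rw [Function.extend_apply' _ _ _ (by simpa using hi)]
    · intro i
      rw [f.injective.extend_apply]
  · intro c
    refine (Fintype.sum_of_injective f f.injective _ _ ?_ ?_).symm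
    · intro i hi
      rw [Function.extend_apply' α _ _ (by simpa using hi), zero_mul]
    · intro i
      rw [f.injective.extend_apply, f.injective.extend_apply]

lemma zb_M (n : ℕ) : 3 * (Nat.sqrt (n / 3)) ^ 2 ≤ n ∧ (3 ≤ n → 0 < Nat.sqrt (n / 3) ∧ n ≤ 12 * (Nat.sqrt (n / 3)) ^ 2) := by
  have h1 := Nat.sqrt_le' (n / 3)
  have h2 := Nat.lt_succ_sqrt' (n / 3)
  set m := Nat.sqrt (n / 3)
  refine ⟨by omega, fun h3 => ?_⟩
  have m0 : 0 < m := by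
    by_contra hc
    have : m = 0 := by omega
    rw [this] at h2
    simp at h2
    omega
  refine ⟨m0, ?_⟩
  have : (m+1)^2 ≤ 4 * m^2 := by nlinarith
  simp only [Nat.succ_eq_add_one] at h2
  omega

lemma zb_pow (n M : ℕ) (hn : 0 < n) (hM : 0 < M) (h : n ≤ 12 * M ^ 2) :
    (M:ℝ) ^ (-(5/2:ℝ)) ≤ (12:ℝ) ^ (5/4:ℝ) * (n:ℝ) ^ (-(5/4:ℝ)) := by
  have e : (M:ℝ) ^ (-(5/2:ℝ)) = ((M:ℝ)^2) ^ (-(5/4:ℝ)) := by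
    rw [← Real.rpow_natCast, ← Real.rpow_mul (by positivity)]; norm_num
  have h2 : (n:ℝ) / 12 ≤ (M:ℝ)^2 := by
    have : (n:ℝ) ≤ 12 * (M:ℝ)^2 := by exact_mod_cast h
    linarith
  have n0 : (0:ℝ) < n := by exact_mod_cast hn
  rw [e]
  refine (Real.rpow_le_rpow_of_nonpos (by positivity) h2 (by norm_num)).trans ?_
  rw [Real.div_rpow n0.le (by norm_num), Real.rpow_neg (by norm_num) (x := 12), div_inv_eq_mul, mul_comm]

open scoped RealInnerProductSpace

lemma zb_trivial (n : ℕ) (hn : 1 ≤ n) : ∃ (v : Fin n → ZbV) (α : Fin n → ℝ),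
        (∀ i, ‖v i‖ = 1) ∧ (∀ i, 0 ≤ α i) ∧ (∑ i, α i = 1) ∧
        ∀ c : ZbV, ‖c‖ = 1 → |(∑ i, α i * |inner ℝ (v i) c|) - 1 / 2| ≤ 1 / 2 := by
  obtain ⟨v, α, h1, h2, h3, h4⟩ := zb_pad (ι := Fin 1) n (by simpa using hn)
    (fun _ => EuclideanSpace.single 2 1) (fun _ => 1) (by simp) (by simp)
  refine ⟨v, α, h1, h2, by simpa using h3, fun c hc => ?_⟩
  rw [h4]
  have := abs_real_inner_le_norm (EuclideanSpace.single 2 1 : ZbV) c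
  simp only [Finset.univ_unique, Finset.sum_const, Finset.card_singleton, one_smul, one_mul]
  rw [hc] at this
  simp only [EuclideanSpace.norm_single, norm_one, mul_one] at this
  rw [abs_le]
  constructor <;> linarith [abs_nonneg (inner ℝ (EuclideanSpace.single 2 1 : ZbV) c)]

/-- Existence of zonotopes with `n` generator directions approximating the Euclidean
ball in `ℝ³` to accuracy `n^(−5/4)`: there is a constant `C > 0` such that for every
`n ≥ 1` there exist unit vectors `nᵢ ∈ ℝ³` and weights `αᵢ ≥ 0` summing to 1 with
`|Σᵢ αᵢ|⟨nᵢ, c⟩| − 1/2| < C·n^(−5/4)` for every unit vector `c`. -/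
theorem zonotope_ball_approximation_dim3 :
    ∃ C : ℝ, 0 < C ∧ ∀ n : ℕ, 1 ≤ n →
      ∃ (v : Fin n → EuclideanSpace ℝ (Fin 3)) (α : Fin n → ℝ),
        (∀ i, ‖v i‖ = 1) ∧ (∀ i, 0 ≤ α i) ∧ (∑ i, α i = 1) ∧
        ∀ c : EuclideanSpace ℝ (Fin 3), ‖c‖ = 1 →
          |(∑ i, α i * |⟪v i, c⟫|) - 1 / 2| < C * (n : ℝ) ^ (-(5 / 4 : ℝ)) := by
  obtain ⟨C, hC, hq⟩ := zb_rawquad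
  set K : ℝ := C * (12:ℝ) ^ (5/4:ℝ) with hK
  have K0 : 0 ≤ K := by positivity
  have t3 : (0:ℝ) < (3:ℝ) ^ (5/4:ℝ) := by positivity
  refine ⟨K + 1 + (3:ℝ) ^ (5/4:ℝ), by positivity, fun n hn => ?_⟩
  have n0 : (0:ℝ) < n := by exact_mod_cast hn
  have N0 : 0 < (n:ℝ) ^ (-(5/4:ℝ)) := by positivity
  by_cases h3 : 3 ≤ n
  · obtain ⟨M0, hM⟩ := (zb_M n).2 h3
    have hM' := (zb_M n).1
    set M := Nat.sqrt (n / 3)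
    have hp := zb_pow n M hn M0 hM
    have hε : C * (M:ℝ) ^ (-(5/2:ℝ)) ≤ K * (n:ℝ) ^ (-(5/4:ℝ)) := by
      rw [hK, mul_assoc]; gcongr
    by_cases h1 : C * (M:ℝ) ^ (-(5/2:ℝ)) ≤ 1
    · obtain ⟨wt, p, a1, a2, a3⟩ := hq M M0
      obtain ⟨v, α, b1, b2, b3, b4⟩ := zb_norm_quad wt p a1 a2 _ h1 a3
      obtain ⟨v', α', c1, c2, c3, c4⟩ := zb_pad n (by simp; nlinarith) v α b1 b2
      refine ⟨v', α', c1, c2, c3.trans b3, fun c hc => ?_⟩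
      rw [c4]
      refine (b4 c hc).trans_lt ?_
      nlinarith [mul_pos t3 N0]
    · obtain ⟨v, α, b1, b2, b3, b4⟩ := zb_trivial n hn
      refine ⟨v, α, b1, b2, b3, fun c hc => ?_⟩
      refine (b4 c hc).trans_lt ?_
      nlinarith [mul_pos t3 N0]
  · obtain ⟨v, α, b1, b2, b3, b4⟩ := zb_trivial n hn
    refine ⟨v, α, b1, b2, b3, fun c hc => ?_⟩
    refine (b4 c hc).trans_lt ?_
    have hn3 : (n:ℝ) ≤ 3 := by exact_mod_cast (by omega : n ≤ 3)
    have h5 : (3:ℝ) ^ (-(5/4:ℝ)) ≤ (n:ℝ) ^ (-(5/4:ℝ)) :=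
      Real.rpow_le_rpow_of_nonpos n0 hn3 (by norm_num)
    have h6 : (3:ℝ) ^ (5/4:ℝ) * (3:ℝ) ^ (-(5/4:ℝ)) = 1 := by
      rw [← Real.rpow_add (by norm_num)]; norm_num
    have h7 := mul_le_mul_of_nonneg_left h5 t3.le
    nlinarith [mul_nonneg K0 N0.le]
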